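/- arXiv:2510.17368 — 3 statements merged into one kernel-verified Lean document; each statement's English description precedes it below -/
import Mathlib

section
/- Let n ≥ 1, r > 1 and R > 0. Then there exists a constant C₀ = C₀(n,r,R) > 0 such that for every t ≥ 0, ∫_{B_{R+t}} (φ(x))^r dx ≤ C₀ e^{rt} (R+t)^{(n−1)(1 − r/2)}, where B_{R+t} = {x ∈ ℝⁿ : |x| ≤ R+t}. -/
open Real Set MeasureTheory
open scoped RealInnerProductSpace

/-- The Zhou test function `φ : ℝⁿ → ℝ`:  `φ(x) = e^x + e^{−x}` for `n = 1`, and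
`φ(x) = ∫_{S^{n−1}} e^{x·ω} dσ_ω` for `n ≥ 2`, the surface measure on the unit sphere being
the `(n−1)`-dimensional Hausdorff measure. -/
noncomputable def zhouPhi (n : ℕ) (x : EuclideanSpace ℝ (Fin n)) : ℝ :=
  if h : n = 1 then Real.exp (x ⟨0, by omega⟩) + Real.exp (-(x ⟨0, by omega⟩))
  else
    ∫ ω in Metric.sphere (0 : EuclideanSpace ℝ (Fin n)) 1,
      Real.exp (⟪x, ω⟫) ∂(μH[(n : ℝ) - 1])

theorem normalize_dist_le {E : Type*} [NormedAddCommGroup E] [NormedSpace ℝ E] (a b : E)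
    (ha : 1 ≤ ‖a‖) (hb : 1 ≤ ‖b‖) :
    ‖‖a‖⁻¹ • a - ‖b‖⁻¹ • b‖ ≤ 2 * ‖a - b‖ := by
  have ha0 : 0 < ‖a‖ := by linarith
  have hb0 : 0 < ‖b‖ := by linarith
  have h1 : ‖a‖⁻¹ • a - ‖b‖⁻¹ • b = ‖a‖⁻¹ • (a - b) + (‖a‖⁻¹ - ‖b‖⁻¹) • b := by
    module
  have h2 : ‖(‖a‖⁻¹ - ‖b‖⁻¹) • b‖ = ‖a‖⁻¹ * |‖b‖ - ‖a‖| := by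
    rw [norm_smul, Real.norm_eq_abs]
    have : ‖a‖⁻¹ - ‖b‖⁻¹ = ‖a‖⁻¹ * ‖b‖⁻¹ * (‖b‖ - ‖a‖) := by field_simp
    rw [this, abs_mul, abs_of_pos (by positivity)]
    field_simp
  have h3 : |‖b‖ - ‖a‖| ≤ ‖a - b‖ := by
    rw [norm_sub_rev a b]; exact abs_norm_sub_norm_le b a
  have h4 : ‖a‖⁻¹ ≤ 1 := inv_le_one_of_one_le₀ ha
  rw [h1]
  refine (norm_add_le _ _).trans ?_
  rw [h2, norm_smul, norm_inv, norm_norm]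
  have h5 := norm_nonneg (a - b)
  nlinarith [mul_le_mul h4 h3 (abs_nonneg _) zero_le_one, mul_le_mul_of_nonneg_right h4 h5]

theorem cap_local (d : ℕ) (e : EuclideanSpace ℝ (Fin (d + 1))) (he : ‖e‖ = 1) (ρ : ℝ)
    (h0 : 0 ≤ ρ) (h1 : ρ ≤ 1) :
    μH[(d : ℝ)] (Metric.sphere (0 : EuclideanSpace ℝ (Fin (d + 1))) 1 ∩ Metric.closedBall e ρ) ≤
      2 ^ (d : ℝ) * (ENNReal.ofReal ((2 * ρ) ^ d) *
        μH[(d : ℝ)] (Metric.ball (0 : EuclideanSpace ℝ (Fin d)) 1)) := by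
  have he0 : e ≠ 0 := by intro h; simp [h] at he
  have : Fact (Module.finrank ℝ (EuclideanSpace ℝ (Fin (d + 1))) = d + 1) := ⟨by simp⟩
  have hfr : Module.finrank ℝ (ℝ ∙ e)ᗮ = d := Submodule.finrank_orthogonal_span_singleton he0
  let L : (ℝ ∙ e)ᗮ ≃ₗᵢ[ℝ] EuclideanSpace ℝ (Fin d) :=
    ((stdOrthonormalBasis ℝ (ℝ ∙ e)ᗮ).reindex (finCongr hfr)).repr
  let A : EuclideanSpace ℝ (Fin d) → EuclideanSpace ℝ (Fin (d + 1)) :=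
    fun w => e + (L.symm w : EuclideanSpace ℝ (Fin (d + 1)))
  have hort : ∀ v : (ℝ ∙ e)ᗮ, ⟪e, (v : EuclideanSpace ℝ (Fin (d + 1)))⟫ = 0 := fun v =>
    Submodule.mem_orthogonal_singleton_iff_inner_right.1 v.2
  have hA1 : ∀ w, 1 ≤ ‖A w‖ := by
    intro w
    have h : ⟪e, A w⟫ = 1 := by
      simp only [A, inner_add_right, hort, real_inner_self_eq_norm_sq, he]; norm_num
    have := real_inner_le_norm e (A w)
    rw [h, he] at this; linarith
  let f : EuclideanSpace ℝ (Fin d) → EuclideanSpace ℝ (Fin (d + 1)) :=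
    fun w => ‖A w‖⁻¹ • A w
  have hf : LipschitzWith 2 f := by
    refine LipschitzWith.of_dist_le_mul fun w w' => ?_
    rw [dist_eq_norm, dist_eq_norm]
    refine (normalize_dist_le _ _ (hA1 w) (hA1 w')).trans ?_
    have : A w - A w' = ((L.symm (w - w') : (ℝ ∙ e)ᗮ) : EuclideanSpace ℝ (Fin (d + 1))) := by
      simp [A, map_sub]
    rw [this, Submodule.norm_coe, LinearIsometryEquiv.norm_map]
    simp
  have hsub : Metric.sphere (0 : EuclideanSpace ℝ (Fin (d + 1))) 1 ∩ Metric.closedBall e ρ ⊆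
      f '' Metric.closedBall 0 (2 * ρ) := by
    rintro ω ⟨hω1, hω2⟩
    have hω : ‖ω‖ = 1 := by simpa using hω1
    have hd : ‖ω - e‖ ≤ ρ := by simpa [dist_eq_norm] using hω2
    set c : ℝ := ⟪e, ω⟫ with hc
    have hsq : ‖ω - e‖ ^ 2 = 2 - 2 * c := by
      rw [norm_sub_sq_real, hω, he, real_inner_comm, ← hc]; ring
    have hn0 := norm_nonneg (ω - e)
    have hc2 : 1 / 2 ≤ c := by nlinarith
    have hc0 : 0 < c := by linarith
    have hv : c⁻¹ • ω - e ∈ (ℝ ∙ e)ᗮ := by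
      rw [Submodule.mem_orthogonal_singleton_iff_inner_right, inner_sub_right, inner_smul_right,
        ← hc, real_inner_self_eq_norm_sq, he]
      field_simp
      norm_num
    have hvn : ‖c⁻¹ • ω - e‖ ≤ 2 * ρ := by
      have h2 : ‖c⁻¹ • ω - e‖ ^ 2 = c⁻¹ ^ 2 - 1 := by
        rw [norm_sub_sq_real, norm_smul, hω, he, real_inner_smul_left, real_inner_comm, ← hc,
          norm_inv, Real.norm_eq_abs, abs_of_pos hc0]
        field_simp
        ring
      have hc1 : c ≤ 1 := by nlinarith [sq_nonneg ‖ω - e‖]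
      have hci : c⁻¹ ≤ 2 := by rw [inv_le_comm₀ hc0 two_pos]; linarith
      have hci0 : 0 < c⁻¹ := by positivity
      have hcc : c⁻¹ * c = 1 := inv_mul_cancel₀ hc0.ne'
      have h3 : c⁻¹ ^ 2 - 1 ≤ (2 * ‖ω - e‖) ^ 2 := by
        have : c⁻¹ ^ 2 - 1 = c⁻¹ ^ 2 * (1 - c) * (1 + c) := by
          linear_combination (c⁻¹ * c + 1) * hcc
        rw [this, mul_pow, hsq]
        have h4 : c⁻¹ ^ 2 ≤ 4 := by nlinarith
        have h5 : c⁻¹ ^ 2 * (1 - c) ≤ 4 * (1 - c) :=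
          mul_le_mul_of_nonneg_right h4 (by linarith)
        nlinarith
      rw [← h2] at h3
      have := abs_le_of_sq_le_sq h3 (by positivity)
      have := (abs_le.1 (abs_le_of_sq_le_sq h3 (by positivity : 0 ≤ 2 * ‖ω - e‖))).2
      linarith
    refine ⟨L ⟨_, hv⟩, ?_, ?_⟩
    · simpa using hvn
    · have : A (L ⟨_, hv⟩) = c⁻¹ • ω := by simp [A]
      simp only [f, this]
      rw [norm_smul, hω, norm_inv, Real.norm_eq_abs, abs_of_pos hc0, smul_smul]
      have : (c⁻¹ * 1)⁻¹ * c⁻¹ = 1 := by field_simp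
      rw [this, one_smul]
  have : Measure.IsAddHaarMeasure (μH[(d : ℝ)] : Measure (EuclideanSpace ℝ (Fin d))) := by
    simpa using MeasureTheory.isAddHaarMeasure_hausdorffMeasure (E := EuclideanSpace ℝ (Fin d))
  calc _ ≤ _ := measure_mono hsub
    _ ≤ _ := hf.hausdorffMeasure_image_le (Nat.cast_nonneg d) _
    _ = _ := by
      rw [Measure.addHaar_closedBall _ _ (by positivity)]
      simp

theorem cap_global (d : ℕ) : ∃ C : ℝ, 0 < C ∧
    μH[(d : ℝ)] (Metric.sphere (0 : EuclideanSpace ℝ (Fin (d + 1))) 1) < ⊤ ∧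
    ∀ e : EuclideanSpace ℝ (Fin (d + 1)), ‖e‖ = 1 → ∀ ρ : ℝ, 0 ≤ ρ →
    μH[(d : ℝ)] (Metric.sphere (0 : EuclideanSpace ℝ (Fin (d + 1))) 1 ∩ Metric.closedBall e ρ) ≤
      ENNReal.ofReal (C * ρ ^ d) := by
  have : Measure.IsAddHaarMeasure (μH[(d : ℝ)] : Measure (EuclideanSpace ℝ (Fin d))) := by
    simpa using MeasureTheory.isAddHaarMeasure_hausdorffMeasure (E := EuclideanSpace ℝ (Fin d))
  have hV : μH[(d : ℝ)] (Metric.ball (0 : EuclideanSpace ℝ (Fin d)) 1) ≠ ⊤ :=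
    measure_ball_lt_top.ne
  have hS : μH[(d : ℝ)] (Metric.sphere (0 : EuclideanSpace ℝ (Fin (d + 1))) 1) < ⊤ := by
    refine (isCompact_sphere _ _).measure_lt_top_of_nhdsWithin fun e he => ?_
    refine ⟨Metric.sphere 0 1 ∩ Metric.closedBall e 1, ?_, ?_⟩
    · exact Filter.inter_mem self_mem_nhdsWithin
        (mem_nhdsWithin_of_mem_nhds (Metric.closedBall_mem_nhds e one_pos))
    · refine (cap_local d e (by simpa using he) 1 zero_le_one le_rfl).trans_lt ?_
      exact ENNReal.mul_lt_top (ENNReal.rpow_lt_top_of_nonneg (by positivity) (by simp))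
        (ENNReal.mul_lt_top ENNReal.ofReal_lt_top hV.lt_top)
  set V := (μH[(d : ℝ)] (Metric.ball (0 : EuclideanSpace ℝ (Fin d)) 1)).toReal with hVd
  set M := (μH[(d : ℝ)] (Metric.sphere (0 : EuclideanSpace ℝ (Fin (d + 1))) 1)).toReal with hM
  have hV0 : 0 ≤ V := ENNReal.toReal_nonneg
  have hM0 : 0 ≤ M := ENNReal.toReal_nonneg
  refine ⟨2 ^ d * 2 ^ d * V + M + 1, by positivity, hS, fun e he ρ hρ => ?_⟩
  rcases le_total ρ 1 with h1 | h1
  · refine (cap_local d e he ρ hρ h1).trans ?_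
    rw [← ENNReal.ofReal_toReal hV, ← hVd, ← ENNReal.ofReal_mul (by positivity),
      ENNReal.rpow_natCast]
    have : (2 : ENNReal) ^ d = ENNReal.ofReal (2 ^ d) := by
      rw [ENNReal.ofReal_pow (by norm_num)]; simp
    rw [this, ← ENNReal.ofReal_mul (by positivity)]
    apply ENNReal.ofReal_le_ofReal
    have : 0 ≤ (M + 1) * ρ ^ d := by positivity
    rw [mul_pow]
    linarith
  · refine (measure_mono inter_subset_left).trans ?_
    rw [← ENNReal.ofReal_toReal hS.ne, ← hM]
    apply ENNReal.ofReal_le_ofReal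
    have h2 : 1 ≤ ρ ^ d := one_le_pow₀ h1
    have : 0 ≤ 2 ^ d * 2 ^ d * V := by positivity
    nlinarith

theorem zhouPhi_bound (d : ℕ) : ∃ C : ℝ, 0 < C ∧ ∀ x : EuclideanSpace ℝ (Fin (d + 1)),
    0 ≤ zhouPhi (d + 1) x ∧
    zhouPhi (d + 1) x ≤ C * Real.exp ‖x‖ * (1 + ‖x‖) ^ (-((d : ℝ) / 2)) := by
  rcases Nat.eq_zero_or_pos d with rfl | hd
  · refine ⟨2, two_pos, fun x => ?_⟩
    simp only [zhouPhi, zero_add, dite_true]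
    refine ⟨by positivity, ?_⟩
    have hx : |x 0| ≤ ‖x‖ := PiLp.norm_apply_le x 0
    have h1 : Real.exp (x 0) ≤ Real.exp ‖x‖ := Real.exp_le_exp.2 ((le_abs_self _).trans hx)
    have h2 : Real.exp (-x 0) ≤ Real.exp ‖x‖ := Real.exp_le_exp.2 ((neg_le_abs _).trans hx)
    have h3 : (1 + ‖x‖) ^ (-(((0 : ℕ) : ℝ) / 2)) = 1 := by simp
    rw [h3]
    change Real.exp (x 0) + Real.exp (-x 0) ≤ _
    linarith
  · obtain ⟨C, hC, hS, hcap⟩ := cap_global d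
    have hsum : Summable fun k : ℕ => Real.exp 1 * Real.exp (-k) * (C * (2 * (k : ℝ)) ^ d) := by
      have := (Real.summable_pow_mul_exp_neg_nat_mul d one_pos).mul_left (Real.exp 1 * C * 2 ^ d)
      refine this.congr fun k => ?_
      rw [mul_pow]
      ring_nf
    set T := ∑' k : ℕ, Real.exp 1 * Real.exp (-k) * (C * (2 * (k : ℝ)) ^ d) with hT
    have hT0 : 0 ≤ T := tsum_nonneg fun k => by positivity
    refine ⟨Real.exp 2 * (T + 1), by positivity, fun x => ?_⟩
    have hne : d + 1 ≠ 1 := by omega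
    simp only [zhouPhi, hne, dite_false]
    have hdim : (((d + 1 : ℕ) : ℝ)) - 1 = d := by push_cast; ring
    rw [hdim]
    refine ⟨integral_nonneg fun _ => (Real.exp_pos _).le, ?_⟩
    obtain ⟨e, he, hxe⟩ : ∃ e : EuclideanSpace ℝ (Fin (d + 1)), ‖e‖ = 1 ∧ x = ‖x‖ • e := by
      by_cases hx : x = 0
      · exact ⟨EuclideanSpace.single 0 1, by simp, by simp [hx]⟩
      · have : ‖x‖ ≠ 0 := norm_ne_zero_iff.2 hx
        exact ⟨‖x‖⁻¹ • x, by rw [norm_smul, norm_inv, norm_norm, inv_mul_cancel₀ this],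
          by rw [smul_smul, mul_inv_cancel₀ this, one_smul]⟩
    set l := ‖x‖ with hl
    have hl0 : 0 ≤ l := norm_nonneg x
    have hl1 : 0 < 1 + l := by linarith
    set s := Real.sqrt (1 + l) with hs
    have hs0 : 0 < s := Real.sqrt_pos.2 hl1
    have hss : s ^ 2 = 1 + l := Real.sq_sqrt hl1.le
    have hspow : (1 + l) ^ (-((d : ℝ) / 2)) = (s ^ d)⁻¹ := by
      rw [Real.rpow_neg hl1.le, hs, Real.sqrt_eq_rpow, ← Real.rpow_natCast, ← Real.rpow_mul hl1.le]
      ring_nf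
    rw [hspow]
    have hcont : Continuous fun ω : EuclideanSpace ℝ (Fin (d + 1)) => Real.exp ⟪x, ω⟫ := by
      fun_prop
    rw [integral_eq_lintegral_of_nonneg_ae (Filter.Eventually.of_forall fun _ => (Real.exp_pos _).le)
      hcont.aestronglyMeasurable]
    refine ENNReal.toReal_le_of_le_ofReal (by positivity) ?_
    let B : ℕ → Set (EuclideanSpace ℝ (Fin (d + 1))) :=
      fun k => Metric.closedBall e (Real.sqrt (2 * k) / s)
    have hpt : ∀ ω ∈ Metric.sphere (0 : EuclideanSpace ℝ (Fin (d + 1))) 1,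
        ENNReal.ofReal (Real.exp ⟪x, ω⟫) ≤ ENNReal.ofReal (Real.exp 2 * Real.exp l) *
          ∑' k : ℕ, (B k).indicator (fun _ => ENNReal.ofReal (Real.exp 1 * Real.exp (-k))) ω := by
      intro ω hω
      have hω : ‖ω‖ = 1 := by simpa using hω
      set q := ‖ω - e‖ ^ 2 / 2 with hq
      have hin : ⟪x, ω⟫ = l * (1 - q) := by
        rw [hxe, real_inner_smul_left, hq, norm_sub_sq_real, hω, he, real_inner_comm]; ring
      have hq2 : q ≤ 2 := by
        have : ‖ω - e‖ ≤ 2 := (norm_sub_le _ _).trans (by rw [hω, he]; norm_num)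
        have h0 := norm_nonneg (ω - e)
        nlinarith
      have hq0 : 0 ≤ q := by positivity
      set k := ⌈(1 + l) * q⌉₊ with hk
      have hk1 : (1 + l) * q ≤ k := Nat.le_ceil _
      have hk2 : (k : ℝ) < (1 + l) * q + 1 := Nat.ceil_lt_add_one (by positivity)
      have hmem : ω ∈ B k := by
        simp only [B, Metric.mem_closedBall, dist_eq_norm]
        rw [le_div_iff₀ hs0]
        apply Real.le_sqrt_of_sq_le
        rw [mul_pow, hss]
        have : ‖ω - e‖ ^ 2 = 2 * q := by rw [hq]; ring
        rw [this]; linarith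
      have h1 := ENNReal.le_tsum (f := fun k : ℕ =>
        (B k).indicator (fun _ => ENNReal.ofReal (Real.exp 1 * Real.exp (-k))) ω) k
      simp only [indicator_of_mem hmem] at h1
      refine le_trans ?_ (mul_le_mul_right h1 _)
      rw [← ENNReal.ofReal_mul (by positivity)]
      apply ENNReal.ofReal_le_ofReal
      rw [← Real.exp_add, ← Real.exp_add, ← Real.exp_add, hin]
      apply Real.exp_le_exp.2
      nlinarith
    calc ∫⁻ ω in Metric.sphere (0 : EuclideanSpace ℝ (Fin (d + 1))) 1,
          ENNReal.ofReal (Real.exp ⟪x, ω⟫) ∂(μH[(d : ℝ)])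
        ≤ ∫⁻ ω in Metric.sphere (0 : EuclideanSpace ℝ (Fin (d + 1))) 1,
          ENNReal.ofReal (Real.exp 2 * Real.exp l) *
          ∑' k : ℕ, (B k).indicator (fun _ => ENNReal.ofReal (Real.exp 1 * Real.exp (-k))) ω
            ∂(μH[(d : ℝ)]) := setLIntegral_mono' Metric.isClosed_sphere.measurableSet hpt
      _ = ENNReal.ofReal (Real.exp 2 * Real.exp l) * ∑' k : ℕ,
          ENNReal.ofReal (Real.exp 1 * Real.exp (-k)) *
            μH[(d : ℝ)] (B k ∩ Metric.sphere (0 : EuclideanSpace ℝ (Fin (d + 1))) 1) := by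
          have hm : ∀ k : ℕ, Measurable ((B k).indicator
              (fun _ => ENNReal.ofReal (Real.exp 1 * Real.exp (-k)))) := fun k =>
            measurable_const.indicator measurableSet_closedBall
          rw [lintegral_const_mul' _ _ ENNReal.ofReal_ne_top,
            lintegral_tsum fun k => (hm k).aemeasurable]
          congr 2
          ext k
          rw [lintegral_indicator_const measurableSet_closedBall,
            Measure.restrict_apply measurableSet_closedBall]
      _ ≤ ENNReal.ofReal (Real.exp 2 * Real.exp l) * ∑' k : ℕ,
          ENNReal.ofReal ((Real.exp 1 * Real.exp (-k) * (C * (2 * (k : ℝ)) ^ d)) * (s ^ d)⁻¹) := by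
          refine mul_le_mul_right (ENNReal.tsum_le_tsum fun k => ?_) _
          rw [inter_comm]
          refine (mul_le_mul_right (hcap e he _ (by positivity)) _).trans ?_
          rw [← ENNReal.ofReal_mul (by positivity)]
          apply ENNReal.ofReal_le_ofReal
          have h2 : Real.sqrt (2 * k) ≤ 2 * k := by
            rcases Nat.eq_zero_or_pos k with rfl | hk
            · simp
            · have : (1 : ℝ) ≤ k := by exact_mod_cast hk
              rw [Real.sqrt_le_left (by positivity)]
              nlinarith
          rw [div_pow, div_eq_mul_inv, mul_assoc (Real.exp 1 * Real.exp (-k)), mul_assoc C]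
          gcongr
      _ = ENNReal.ofReal (Real.exp 2 * Real.exp l) * ENNReal.ofReal (T * (s ^ d)⁻¹) := by
          rw [hT, ← tsum_mul_right, ENNReal.ofReal_tsum_of_nonneg (fun k => by positivity)
            (hsum.mul_right _)]
      _ ≤ _ := by
          rw [← ENNReal.ofReal_mul (by positivity)]
          apply ENNReal.ofReal_le_ofReal
          have : 0 ≤ Real.exp 2 * Real.exp l * (s ^ d)⁻¹ := by positivity
          nlinarith

theorem one_add_rpow_le_exp (b c : ℝ) (hb : 0 ≤ b) (hc : 0 < c) :
    ∃ K : ℝ, 0 < K ∧ ∀ s : ℝ, 0 ≤ s → (1 + s) ^ b ≤ K * Real.exp (c * s) := by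
  -- use `1 + s ≤ (1 + b / c) * exp (c * s / (b + 1))`-type estimate
  refine ⟨(1 + (b + 1) / c) ^ b, by positivity, fun s hs => ?_⟩
  have h1 : 1 + s ≤ (1 + (b + 1) / c) * Real.exp (c * s / (b + 1)) := by
    have h2 := Real.add_one_le_exp (c * s / (b + 1))
    have h3 : 0 ≤ c * s / (b + 1) := by positivity
    have h4 : s = (b + 1) / c * (c * s / (b + 1)) := by field_simp
    have h5 : 0 < (b + 1) / c := by positivity
    nlinarith
  calc (1 + s) ^ b ≤ ((1 + (b + 1) / c) * Real.exp (c * s / (b + 1))) ^ b :=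
        Real.rpow_le_rpow (by positivity) h1 hb
    _ = (1 + (b + 1) / c) ^ b * Real.exp (c * s / (b + 1) * b) := by
        rw [Real.mul_rpow (by positivity) (Real.exp_pos _).le, ← Real.exp_mul]
    _ ≤ _ := by
        refine mul_le_mul_of_nonneg_left (Real.exp_le_exp.2 ?_) (by positivity)
        rw [div_mul_eq_mul_div, div_le_iff₀ (by positivity)]
        have : 0 ≤ c * s := by positivity
        nlinarith

theorem peetre_real (a y T : ℝ) (hy : 0 ≤ y) (hyT : y ≤ T) :
    (1 + y) ^ a ≤ (1 + (T - y)) ^ |a| * (1 + T) ^ a := by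
  rcases le_total 0 a with ha | ha
  · have h1 : 1 ≤ (1 + (T - y)) ^ |a| := Real.one_le_rpow (by linarith) (abs_nonneg _)
    have h2 : (1 + y) ^ a ≤ (1 + T) ^ a := Real.rpow_le_rpow (by linarith) (by linarith) ha
    have h3 : 0 ≤ (1 + T) ^ a := Real.rpow_nonneg (by linarith) _
    nlinarith
  · have h0 : 0 < 1 + y := by linarith
    have h1 : 0 < 1 + (T - y) := by linarith
    have h2 : 0 < 1 + T := by linarith
    rw [abs_of_nonpos ha, Real.rpow_neg h1.le, ← div_eq_inv_mul, ← Real.div_rpow h2.le h1.le]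
    refine Real.rpow_le_rpow_of_nonpos (by positivity) ?_ ha
    rw [div_le_iff₀ h1]
    nlinarith [mul_nonneg hy (sub_nonneg.2 hyT)]

theorem one_add_rpow_le (a R T : ℝ) (hR : 0 < R) (hT : R ≤ T) :
    (1 + T) ^ a ≤ (1 + 1 / R) ^ |a| * T ^ a := by
  have hT0 : 0 < T := by linarith
  have hR1 : 1 ≤ 1 + 1 / R := by have : 0 < 1 / R := by positivity
                                 linarith
  rcases le_total 0 a with ha | ha
  · rw [abs_of_nonneg ha, ← Real.mul_rpow (by positivity) hT0.le]
    refine Real.rpow_le_rpow (by linarith) ?_ ha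
    have : 1 ≤ 1 / R * T := by rw [div_mul_eq_mul_div, le_div_iff₀ hR]; linarith
    linarith
  · have h1 : 1 ≤ (1 + 1 / R) ^ |a| := Real.one_le_rpow hR1 (abs_nonneg _)
    have h2 : (1 + T) ^ a ≤ T ^ a := Real.rpow_le_rpow_of_nonpos hT0 (by linarith) ha
    have h3 : 0 ≤ T ^ a := by positivity
    nlinarith

/-- For `n ≥ 1`, `r > 1` and `R > 0` there is `C₀ = C₀(n,r,R) > 0` such that
`∫_{B_{R+t}} φ(x)^r dx ≤ C₀ e^{rt} (R+t)^{(n−1)(1−r/2)}` for every `t ≥ 0`. -/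
theorem zhouPhi_rpow_integral_bound
    (n : ℕ) (hn : 1 ≤ n) (r R : ℝ) (hr : 1 < r) (hR : 0 < R) :
    ∃ C₀ > 0, ∀ t : ℝ, 0 ≤ t →
      ∫ x in Metric.closedBall (0 : EuclideanSpace ℝ (Fin n)) (R + t), zhouPhi n x ^ r ≤
        C₀ * Real.exp (r * t) * (R + t) ^ (((n : ℝ) - 1) * (1 - r / 2)) := by
  obtain ⟨d, rfl⟩ : ∃ d, n = d + 1 := ⟨n - 1, by omega⟩
  have hdim : (((d + 1 : ℕ) : ℝ)) - 1 = d := by push_cast; ring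
  rw [hdim]
  set a : ℝ := (d : ℝ) * (1 - r / 2) with ha
  obtain ⟨C, hC, hphi⟩ := zhouPhi_bound d
  have hr2 : 0 < r / 2 := by linarith
  obtain ⟨K, hK, hKb⟩ := one_add_rpow_le_exp |a| (r / 2) (abs_nonneg a) hr2
  set V : ℝ := volume.real (Metric.ball (0 : EuclideanSpace ℝ (Fin (d + 1))) 1) with hV
  have hV0 : 0 ≤ V := measureReal_nonneg
  set Q : ℝ := C ^ r * (((d + 1 : ℕ) : ℝ) * (V * (K * (2 / r)))) *
    (Real.exp (r * R) * (1 + 1 / R) ^ |a|) with hQ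
  have hQ0 : 0 ≤ Q := by positivity
  refine ⟨Q + 1, by positivity, fun t ht => ?_⟩
  set T := R + t with hT
  have hT0 : 0 < T := by linarith
  let h : ℝ → ℝ := fun y => Real.exp (r * y) * (1 + y) ^ (-((d : ℝ) / 2) * r)
  have hh0 : ∀ y, 0 ≤ y → 0 ≤ h y := fun y hy =>
    mul_nonneg (Real.exp_pos _).le (Real.rpow_nonneg (by linarith) _)
  -- pointwise bound on the integrand
  have hpt : ∀ x : EuclideanSpace ℝ (Fin (d + 1)), zhouPhi (d + 1) x ^ r ≤ C ^ r * h ‖x‖ := by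
    intro x
    have hx : 0 ≤ 1 + ‖x‖ := by positivity
    refine (Real.rpow_le_rpow (hphi x).1 (hphi x).2 (by linarith)).trans_eq ?_
    rw [Real.mul_rpow (by positivity) (by positivity), Real.mul_rpow hC.le (Real.exp_pos _).le,
      ← Real.exp_mul, ← Real.rpow_mul hx, mul_assoc, mul_comm ‖x‖ r]
  have hcont : Continuous fun x : EuclideanSpace ℝ (Fin (d + 1)) => C ^ r * h ‖x‖ := by
    refine continuous_const.mul ((by fun_prop : Continuous fun x : EuclideanSpace ℝ (Fin (d + 1)) =>
      Real.exp (r * ‖x‖)).mul ?_)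
    refine Continuous.rpow_const (by fun_prop) fun x => Or.inl ?_
    have : 0 ≤ ‖x‖ := norm_nonneg x
    linarith
  have step1 : ∫ x in Metric.closedBall (0 : EuclideanSpace ℝ (Fin (d + 1))) T,
      zhouPhi (d + 1) x ^ r ≤
      ∫ x in Metric.closedBall (0 : EuclideanSpace ℝ (Fin (d + 1))) T, C ^ r * h ‖x‖ :=
    integral_mono_of_nonneg
      (Filter.Eventually.of_forall fun x => Real.rpow_nonneg (hphi x).1 _)
      (hcont.continuousOn.integrableOn_compact (isCompact_closedBall _ _))
      (Filter.Eventually.of_forall hpt)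
  have step2 : ∫ x in Metric.closedBall (0 : EuclideanSpace ℝ (Fin (d + 1))) T, C ^ r * h ‖x‖ =
      C ^ r * (((d + 1 : ℕ) : ℝ) * (V * ∫ y in Ioi (0 : ℝ), y ^ d * (Iic T).indicator h y)) := by
    rw [integral_const_mul, ← integral_indicator measurableSet_closedBall]
    have : (Metric.closedBall (0 : EuclideanSpace ℝ (Fin (d + 1))) T).indicator
        (fun x => h ‖x‖) = fun x => (Iic T).indicator h ‖x‖ := by
      ext x
      simp only [indicator, Metric.mem_closedBall, dist_zero_right, mem_Iic]
    rw [this, integral_fun_norm_addHaar volume]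
    simp [nsmul_eq_mul, hV]
  let g : ℝ → ℝ := fun y => (K * (1 + T) ^ a * Real.exp (r / 2 * T)) * Real.exp (r / 2 * y)
  have hT1 : 0 ≤ (1 + T) ^ a := by positivity
  have hg0 : ∀ y, 0 ≤ g y := fun y => by positivity
  have hgi : IntegrableOn g (Iic T) := (integrableOn_exp_mul_Iic hr2 T).const_mul _
  have step3 : ∫ y in Ioi (0 : ℝ), y ^ d * (Iic T).indicator h y ≤
      K * (2 / r) * (Real.exp (r * T) * (1 + T) ^ a) := by
    have hgI : Integrable ((Iic T).indicator g) := hgi.integrable_indicator measurableSet_Iic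
    calc ∫ y in Ioi (0 : ℝ), y ^ d * (Iic T).indicator h y
        ≤ ∫ y in Ioi (0 : ℝ), (Iic T).indicator g y := by
          refine integral_mono_of_nonneg ?_ hgI.integrableOn ?_
          · filter_upwards [ae_restrict_mem measurableSet_Ioi] with y hy
            have hy : 0 < y := hy
            by_cases hyT : y ∈ Iic T
            · simp only [indicator_of_mem hyT]
              exact mul_nonneg (by positivity) (hh0 y hy.le)
            · simp [indicator_of_notMem hyT]
          · filter_upwards [ae_restrict_mem measurableSet_Ioi] with y hy
            have hy : 0 < y := hy
            by_cases hyT : y ∈ Iic T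
            · simp only [indicator_of_mem hyT]
              have hyT : y ≤ T := hyT
              have hy1 : 0 < 1 + y := by linarith
              have e1 : y ^ d ≤ (1 + y) ^ (d : ℝ) := by
                rw [Real.rpow_natCast]; gcongr; linarith
              calc y ^ d * h y ≤ (1 + y) ^ (d : ℝ) * h y :=
                    mul_le_mul_of_nonneg_right e1 (hh0 y hy.le)
                _ = Real.exp (r * y) * (1 + y) ^ a := by
                    simp only [h]
                    rw [mul_left_comm, ← Real.rpow_add hy1, ha]
                    ring_nf
                _ ≤ Real.exp (r * y) * ((K * Real.exp (r / 2 * (T - y))) * (1 + T) ^ a) := by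
                    gcongr
                    refine (peetre_real a y T hy.le hyT).trans ?_
                    gcongr
                    exact hKb _ (by linarith)
                _ = g y := by
                    simp only [g]
                    have : Real.exp (r * y) * Real.exp (r / 2 * (T - y)) =
                        Real.exp (r / 2 * T) * Real.exp (r / 2 * y) := by
                      rw [← Real.exp_add, ← Real.exp_add]; ring_nf
                    linear_combination K * (1 + T) ^ a * this
            · simp [indicator_of_notMem hyT]
      _ ≤ ∫ y, (Iic T).indicator g y :=
          setIntegral_le_integral hgI
            (Filter.Eventually.of_forall fun y => indicator_nonneg (fun y _ => hg0 y) y)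
      _ = ∫ y in Iic T, g y := integral_indicator measurableSet_Iic
      _ = K * (2 / r) * (Real.exp (r * T) * (1 + T) ^ a) := by
          simp only [g]
          rw [integral_const_mul, integral_exp_mul_Iic hr2]
          have : Real.exp (r * T) = Real.exp (r / 2 * T) * Real.exp (r / 2 * T) := by
            rw [← Real.exp_add]; ring_nf
          rw [this]
          field_simp
  have step4 : Real.exp (r * T) * (1 + T) ^ a ≤
      (Real.exp (r * R) * (1 + 1 / R) ^ |a|) * (Real.exp (r * t) * T ^ a) := by
    have e1 : Real.exp (r * T) = Real.exp (r * R) * Real.exp (r * t) := by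
      rw [← Real.exp_add, hT]; ring_nf
    rw [e1]
    calc _ ≤ Real.exp (r * R) * Real.exp (r * t) * ((1 + 1 / R) ^ |a| * T ^ a) := by
          gcongr
          exact one_add_rpow_le a R T hR (by linarith)
      _ = _ := by ring
  calc _ ≤ _ := step1
    _ = _ := step2
    _ ≤ C ^ r * (((d + 1 : ℕ) : ℝ) * (V * (K * (2 / r) *
        ((Real.exp (r * R) * (1 + 1 / R) ^ |a|) * (Real.exp (r * t) * T ^ a))))) := by
        gcongr
        exact step3.trans (mul_le_mul_of_nonneg_left step4 (by positivity))
    _ = Q * (Real.exp (r * t) * T ^ a) := by rw [hQ]; ring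
    _ ≤ _ := by
        have : 0 ≤ Real.exp (r * t) * T ^ a := by positivity
        linarith
end

section
/- Let b : [0,∞) → [0,∞) be a nonnegative, continuous, integrable function. Let B, B̃, R > 0, p, q > 1, r, ρ ∈ ℝ, and let F, G ∈ C²([0,T)) satisfy F''(t) + F'(t) ≥ B (R+t)^{−r} |G(t)|^p and G''(t) + b(t) G'(t) ≥ B̃ (R+t)^{−ρ} |F(t)|^q for all t ∈ [0,T), together with F(0), F'(0), G(0), G'(0) ≥ 0. Suppose that for some T₀ > 0, A > 0 and a ∈ ℝ one has F(t) ≥ A t^a for all t ∈ [T₀,T), and that a(pq−1) + 2p + 1 > ρp + r. Then there exist constants A₀ = A₀(a,T₀,R,p,q,r,ρ,b,B,B̃) > 0 and C > 0 independent of A such that if A ∈ (0, A₀], then T is finite and T ≤ C A^{−1/γ}, where γ = a + (2p + 1 − (ρp + r))/(pq−1). -/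
open Real Set MeasureTheory

lemma aux_mono {T : ℝ} {f f' : ℝ → ℝ}
    (hf : ∀ t ∈ Set.Ico (0 : ℝ) T, HasDerivWithinAt f (f' t) (Set.Ico 0 T) t)
    {s u : ℝ} (hs : 0 ≤ s) (hsu : s ≤ u) (hu : u < T)
    (h : ∀ t ∈ Set.Icc s u, 0 ≤ f' t) : f s ≤ f u := by
  have hsub : Set.Icc s u ⊆ Set.Ico 0 T := fun t ht => ⟨hs.trans ht.1, ht.2.trans_lt hu⟩
  have := monotoneOn_of_hasDerivWithinAt_nonneg (D := Set.Icc s u) (f := f) (f' := f')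
    (convex_Icc s u)
    (fun t ht => ((hf t (hsub ht)).mono hsub).continuousWithinAt)
    (fun t ht => (hf t (hsub (interior_subset ht))).mono (interior_subset.trans hsub))
    (fun t ht => h t (interior_subset ht))
  exact this ⟨le_refl _, hsu⟩ ⟨hsu, le_refl _⟩ hsu

lemma aux_weight (b : ℝ → ℝ)
    (hb_nonneg : ∀ t, 0 ≤ t → 0 ≤ b t)
    (hb_cont : ContinuousOn b (Set.Ici 0))
    (hb_int : IntegrableOn b (Set.Ioi 0) volume) :
    ∃ (m : ℝ → ℝ) (M : ℝ), 1 ≤ M ∧ (∀ t, 0 ≤ t → HasDerivAt m (b t * m t) t) ∧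
      ∀ t, 0 ≤ t → 1 ≤ m t ∧ m t ≤ M := by
  have hc : Continuous (fun t : ℝ => b (max t 0)) :=
    hb_cont.comp_continuous (by fun_prop) (fun t => by simp)
  have key : ∀ t, 0 ≤ t → 0 ≤ (∫ x in (0:ℝ)..t, b (max x 0)) ∧
      (∫ x in (0:ℝ)..t, b (max x 0)) ≤ ∫ x in Set.Ioi 0, b x := by
    intro t ht
    refine ⟨intervalIntegral.integral_nonneg ht
      (fun x _ => hb_nonneg _ (le_max_right _ _)), ?_⟩
    rw [intervalIntegral.integral_of_le ht]
    have e : ∫ x in Set.Ioc 0 t, b (max x 0) = ∫ x in Set.Ioc 0 t, b x := by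
      apply setIntegral_congr_fun measurableSet_Ioc
      intro x hx
      simp [max_eq_left hx.1.le]
    rw [e]
    apply setIntegral_mono_set hb_int
    · filter_upwards [ae_restrict_mem measurableSet_Ioi] with x hx
      exact hb_nonneg x (le_of_lt hx)
    · exact (Set.Ioc_subset_Ioi_self).eventuallyLE
  refine ⟨fun t => exp (∫ x in (0:ℝ)..t, b (max x 0)), exp (∫ x in Set.Ioi 0, b x), ?_, ?_, ?_⟩
  · apply Real.one_le_exp
    exact (key 0 le_rfl).1.trans (key 0 le_rfl).2
  · intro t ht
    have h1 : HasDerivAt (fun t => ∫ x in (0:ℝ)..t, b (max x 0)) (b (max t 0)) t :=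
      hc.integral_hasStrictDerivAt 0 t |>.hasDerivAt
    have h2 := h1.exp
    rw [max_eq_left ht] at h2
    rw [mul_comm]
    exact h2
  · intro t ht
    exact ⟨Real.one_le_exp (key t ht).1, Real.exp_le_exp.2 (key t ht).2⟩

lemma aux_rpow_lower {R τ : ℝ} (hR : 0 < R) (hτ : R ≤ τ) (r : ℝ) {t : ℝ}
    (h1 : τ ≤ t) (h2 : t ≤ 2 * τ) :
    min 1 ((3:ℝ) ^ (-r)) * τ ^ (-r) ≤ (R + t) ^ (-r) := by
  have hτ0 : 0 < τ := hR.trans_le hτ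
  rcases le_total 0 (-r) with h | h
  · calc _ ≤ 1 * τ ^ (-r) := by gcongr; exact min_le_left _ _
      _ = τ ^ (-r) := one_mul _
      _ ≤ _ := Real.rpow_le_rpow hτ0.le (by linarith) h
  · calc _ ≤ (3:ℝ) ^ (-r) * τ ^ (-r) := by gcongr; exact min_le_right _ _
      _ = (3 * τ) ^ (-r) := (Real.mul_rpow (by norm_num) hτ0.le).symm
      _ ≤ _ := Real.rpow_le_rpow_of_nonpos (by linarith) (by linarith) h

lemma aux_alg {cB cB' M p q r ρ τ y Φ : ℝ} (hτ : 0 < τ) (hM : 0 < M) (hB : 0 < cB)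
    (hB' : 0 < cB') (hy : 0 < y) (hΦ : 0 < Φ) :
    (τ * y / 6) * ((cB * τ ^ (-r)) * ((cB' * τ ^ (-ρ) * Φ ^ q) * (τ * y / 6) ^ 2 / (2 * M)) ^ p
      * (y / 12)) =
    (1 / 72 * cB * (cB' / (72 * M)) ^ p) * τ ^ (2 * p + 1 - (ρ * p + r)) * y ^ (2 + 2 * p)
      * Φ ^ (p * q) := by
  have e1 : (cB' * τ ^ (-ρ) * Φ ^ q) * (τ * y / 6) ^ 2 / (2 * M) =
      (cB' / (72 * M)) * τ ^ (2 - ρ) * y ^ (2:ℝ) * Φ ^ q := by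
    rw [show (2 - ρ) = -ρ + (2:ℕ) by push_cast; ring, Real.rpow_add hτ, Real.rpow_natCast,
      Real.rpow_two]
    field_simp
    ring
  rw [e1, Real.mul_rpow (by positivity) (by positivity),
    Real.mul_rpow (by positivity) (by positivity),
    Real.mul_rpow (by positivity) (by positivity), ← Real.rpow_mul hτ.le, ← Real.rpow_mul hy.le,
    ← Real.rpow_mul hΦ.le, show 2 * p + 1 - (ρ * p + r) = 1 + (-r) + (2 - ρ) * p by ring,
    Real.rpow_add hτ, Real.rpow_add hτ, Real.rpow_one, Real.rpow_add hy, Real.rpow_two,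
    mul_comm q p]
  ring

lemma aux_step {b m F F' F'' G G' G'' : ℝ → ℝ} {B B' R p q r ρ T M τ : ℝ}
    (hB : 0 < B) (hB' : 0 < B') (hR : 0 < R) (hp : 1 < p) (hq : 1 < q)
    (hM : 1 ≤ M) (hb_nonneg : ∀ t, 0 ≤ t → 0 ≤ b t)
    (hm : ∀ t, 0 ≤ t → HasDerivAt m (b t * m t) t)
    (hmM : ∀ t, 0 ≤ t → 1 ≤ m t ∧ m t ≤ M)
    (hF : ∀ t ∈ Set.Ico (0 : ℝ) T, HasDerivWithinAt F (F' t) (Set.Ico 0 T) t)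
    (hF' : ∀ t ∈ Set.Ico (0 : ℝ) T, HasDerivWithinAt F' (F'' t) (Set.Ico 0 T) t)
    (hG : ∀ t ∈ Set.Ico (0 : ℝ) T, HasDerivWithinAt G (G' t) (Set.Ico 0 T) t)
    (hG' : ∀ t ∈ Set.Ico (0 : ℝ) T, HasDerivWithinAt G' (G'' t) (Set.Ico 0 T) t)
    (h1 : ∀ t ∈ Set.Ico (0 : ℝ) T, B * (R + t) ^ (-r) * |G t| ^ p ≤ F'' t + F' t)
    (h2 : ∀ t ∈ Set.Ico (0 : ℝ) T,
          B' * (R + t) ^ (-ρ) * |F t| ^ q ≤ G'' t + b t * G' t)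
    (hF'0 : 0 ≤ F' 0) (hG0 : 0 ≤ G 0) (hG'0 : 0 ≤ G' 0)
    (hτ1 : 1 ≤ τ) (hτR : R ≤ τ) (hτT : 2 * τ < T)
    {s y Φ : ℝ} (hs : τ ≤ s) (hy : 0 < y) (hy1 : y ≤ 1) (hsy : s + τ * y / 2 ≤ 2 * τ)
    (hΦ : 0 < Φ) (hFs : Φ ≤ F s) :
    (1 / 72 * (B * min 1 ((3:ℝ) ^ (-r))) * ((B' * min 1 ((3:ℝ) ^ (-ρ))) / (72 * M)) ^ p)
      * τ ^ (2 * p + 1 - (ρ * p + r)) * y ^ (2 + 2 * p) * Φ ^ (p * q) ≤ F (s + τ * y / 2) := by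
  have hτ : 0 < τ := by linarith
  have hM0 : 0 < M := by linarith
  have hcr : 0 < min 1 ((3:ℝ) ^ (-r)) := lt_min one_pos (by positivity)
  have hcρ : 0 < min 1 ((3:ℝ) ^ (-ρ)) := lt_min one_pos (by positivity)
  -- derivatives of weighted functions
  have dE : ∀ K : ℝ, ∀ t ∈ Set.Ico (0 : ℝ) T, HasDerivWithinAt (fun t => exp t * (F' t - K))
      (exp t * (F' t - K) + exp t * F'' t) (Set.Ico 0 T) t := fun K t ht =>
    (Real.hasDerivAt_exp t).hasDerivWithinAt.mul ((hF' t ht).sub_const K)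
  have dM : ∀ K : ℝ, ∀ t ∈ Set.Ico (0 : ℝ) T, HasDerivWithinAt (fun t => m t * G' t - K * t)
      ((b t * m t) * G' t + m t * G'' t - K * 1) (Set.Ico 0 T) t := fun K t ht =>
    ((hm t ht.1).hasDerivWithinAt.mul (hG' t ht)).sub ((hasDerivWithinAt_id t _).const_mul K)
  have hF'nn : ∀ t ∈ Set.Ico (0 : ℝ) T, 0 ≤ F' t := by
    intro t ht
    have := aux_mono (dE 0) le_rfl ht.1 ht.2 (fun x hx => by
      have hx' : x ∈ Set.Ico (0 : ℝ) T := ⟨hx.1, hx.2.trans_lt ht.2⟩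
      have a1 := h1 x hx'
      have a2 : 0 ≤ B * (R + x) ^ (-r) * |G x| ^ p := by
        have : 0 ≤ R + x := by linarith [hx.1]
        positivity
      have : 0 ≤ exp x * (F'' x + F' x) := mul_nonneg (exp_pos x).le (a2.trans a1)
      linarith)
    simp only [exp_zero, one_mul, sub_zero] at this
    exact nonneg_of_mul_nonneg_right (hF'0.trans this) (exp_pos t)
  have hG'nn : ∀ t ∈ Set.Ico (0 : ℝ) T, 0 ≤ G' t := by
    intro t ht
    have := aux_mono (dM 0) le_rfl ht.1 ht.2 (fun x hx => by
      have hx' : x ∈ Set.Ico (0 : ℝ) T := ⟨hx.1, hx.2.trans_lt ht.2⟩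
      have a1 := h2 x hx'
      have a2 : 0 ≤ B' * (R + x) ^ (-ρ) * |F x| ^ q := by
        have : 0 ≤ R + x := by linarith [hx.1]
        positivity
      have : 0 ≤ m x * (G'' x + b x * G' x) :=
        mul_nonneg (by linarith [(hmM x hx.1).1]) (a2.trans a1)
      linarith)
    simp only [zero_mul, sub_zero] at this
    have hm0 : 0 ≤ m 0 * G' 0 := mul_nonneg (by linarith [(hmM 0 le_rfl).1]) hG'0
    exact nonneg_of_mul_nonneg_right (hm0.trans this) (by linarith [(hmM t ht.1).1])
  have hFmono : ∀ x u : ℝ, 0 ≤ x → x ≤ u → u < T → F x ≤ F u := fun x u hx hxu hu =>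
    aux_mono hF hx hxu hu (fun t ht => hF'nn t ⟨hx.trans ht.1, ht.2.trans_lt hu⟩)
  have hGmono : ∀ x u : ℝ, 0 ≤ x → x ≤ u → u < T → G x ≤ G u := fun x u hx hxu hu =>
    aux_mono hG hx hxu hu (fun t ht => hG'nn t ⟨hx.trans ht.1, ht.2.trans_lt hu⟩)
  have hs0 : 0 ≤ s := by linarith
  obtain ⟨l, hl⟩ : ∃ l, l = τ * y / 6 := ⟨_, rfl⟩
  have hl0 : 0 < l := by rw [hl]; positivity
  have hend : s + τ * y / 2 = s + 3 * l := by rw [hl]; ring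
  rw [hend] at hsy ⊢
  rw [← aux_alg hτ hM0 (by positivity) (by positivity) hy hΦ, ← hl]
  set K1 := B' * min 1 ((3:ℝ) ^ (-ρ)) * τ ^ (-ρ) * Φ ^ q with hK1
  have hK1p : 0 < K1 := by positivity
  set K2 := B * min 1 ((3:ℝ) ^ (-r)) * τ ^ (-r) * (K1 * l ^ 2 / (2 * M)) ^ p with hK2
  have hK2p : 0 < K2 := by positivity
  -- G' lower bound
  have g1 : ∀ t ∈ Set.Icc s (s + 3 * l), K1 * (t - s) / M ≤ G' t := by
    intro t ht
    have htT : t < T := by linarith [ht.2]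
    have := aux_mono (dM K1) hs0 ht.1 htT (fun x hx => by
      have hx0 : 0 ≤ x := hs0.trans hx.1
      have hx' : x ∈ Set.Ico (0 : ℝ) T := ⟨hx0, hx.2.trans_lt htT⟩
      have a1 := h2 x hx'
      have a3 := aux_rpow_lower hR hτR ρ (t := x) (hs.trans hx.1) (by linarith [hx.2, ht.2])
      have a4 : Φ ≤ |F x| := (hFs.trans (hFmono s x hs0 hx.1 hx'.2)).trans (le_abs_self _)
      have a5 : K1 ≤ B' * (R + x) ^ (-ρ) * |F x| ^ q := by
        rw [hK1, mul_assoc B']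
        have : Φ ^ q ≤ |F x| ^ q := Real.rpow_le_rpow hΦ.le a4 (by linarith)
        gcongr
      have a6 : 1 * K1 ≤ m x * (G'' x + b x * G' x) :=
        mul_le_mul (hmM x hx0).1 (a5.trans a1) hK1p.le (by linarith [(hmM x hx0).1])
      linarith)
    have b1 : 0 ≤ m s * G' s :=
      mul_nonneg (by linarith [(hmM s hs0).1]) (hG'nn s ⟨hs0, by linarith⟩)
    have b2 : m t * G' t ≤ M * G' t :=
      mul_le_mul_of_nonneg_right (hmM t (hs0.trans ht.1)).2 (hG'nn t ⟨hs0.trans ht.1, htT⟩)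
    rw [div_le_iff₀ hM0]
    linarith
  have g2 : K1 * l ^ 2 / (2 * M) ≤ G (s + l) := by
    have dG : ∀ t ∈ Set.Ico (0 : ℝ) T, HasDerivWithinAt
        (fun t => G t - K1 / (2 * M) * (t - s) ^ 2)
        (G' t - K1 / (2 * M) * (2 * (t - s))) (Set.Ico 0 T) t := fun t ht => by
      have e : HasDerivAt (fun t : ℝ => (t - s) ^ 2) (2 * (t - s)) t := by
        have e0 := ((hasDerivAt_id t).sub_const s).fun_pow 2
        simpa using e0
      exact (hG t ht).sub (e.hasDerivWithinAt.const_mul _)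
    have := aux_mono dG hs0 (u := s + l) (by linarith) (by linarith) (fun x hx => by
      have := g1 x ⟨hx.1, by linarith [hx.2]⟩
      have e : K1 / (2 * M) * (2 * (x - s)) = K1 * (x - s) / M := by field_simp
      rw [e]; linarith)
    simp only [sub_self, add_sub_cancel_left] at this
    have b0 : 0 ≤ G s := hG0.trans (hGmono 0 s le_rfl hs0 (by linarith))
    have e : K1 * l ^ 2 / (2 * M) = K1 / (2 * M) * l ^ 2 := by ring
    rw [e]
    norm_num at this
    linarith
  have f1 : ∀ t ∈ Set.Icc (s + l) (s + 3 * l), K2 * (1 - exp (-(t - (s + l)))) ≤ F' t := by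
    intro t ht
    have htT : t < T := by linarith [ht.2]
    have := aux_mono (dE K2) (s := s + l) (by linarith) ht.1 htT (fun x hx => by
      have hx0 : 0 ≤ x := by linarith [hx.1]
      have hx' : x ∈ Set.Ico (0 : ℝ) T := ⟨hx0, hx.2.trans_lt htT⟩
      have a1 := h1 x hx'
      have a3 := aux_rpow_lower hR hτR r (t := x) (by linarith [hx.1]) (by linarith [hx.2, ht.2])
      have a4 : K1 * l ^ 2 / (2 * M) ≤ |G x| :=
        (g2.trans (hGmono (s + l) x (by linarith) hx.1 hx'.2)).trans (le_abs_self _)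
      have a5 : K2 ≤ B * (R + x) ^ (-r) * |G x| ^ p := by
        rw [hK2, mul_assoc B]
        have : (K1 * l ^ 2 / (2 * M)) ^ p ≤ |G x| ^ p :=
          Real.rpow_le_rpow (by positivity) a4 (by linarith)
        gcongr
      have a6 : 0 ≤ exp x * (F'' x + F' x - K2) :=
        mul_nonneg (exp_pos x).le (by linarith)
      linarith)
    have b1 := hF'nn (s + l) ⟨by linarith, by linarith⟩
    have b2 : 0 ≤ exp (s + l) * F' (s + l) := mul_nonneg (exp_pos _).le b1
    have e : exp (-(t - (s + l))) * exp t = exp (s + l) := by rw [← exp_add]; ring_nf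
    have : 0 ≤ exp t * (F' t - K2 * (1 - exp (-(t - (s + l))))) := by
      have : exp t * (F' t - K2 * (1 - exp (-(t - (s + l))))) =
        exp t * (F' t - K2) + K2 * (exp (-(t - (s + l))) * exp t) := by ring
      rw [this, e]; linarith
    linarith [nonneg_of_mul_nonneg_right this (exp_pos t)]
  have hy12 : y / 12 ≤ 1 - exp (-l) := by
    have c1 : y / 6 ≤ l := by rw [hl]; nlinarith
    have c2 : exp (-l) ≤ exp (-(y / 6)) := exp_le_exp.2 (by linarith)
    have c3 : exp (-(y / 6)) ≤ 1 / (1 + y / 6) := by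
      rw [exp_neg, ← one_div]
      apply one_div_le_one_div_of_le (by positivity)
      linarith [add_one_le_exp (y / 6)]
    have c4 : 1 / (1 + y / 6) ≤ 1 - y / 12 := by
      rw [div_le_iff₀ (by positivity)]; nlinarith
    linarith
  have dF : ∀ t ∈ Set.Ico (0 : ℝ) T, HasDerivWithinAt
      (fun t => F t - K2 * (y / 12) * t) (F' t - K2 * (y / 12) * 1) (Set.Ico 0 T) t :=
    fun t ht => (hF t ht).sub ((hasDerivWithinAt_id t _).const_mul _)
  have := aux_mono dF (s := s + 2 * l) (u := s + 3 * l) (by linarith) (by linarith) (by linarith)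
    (fun x hx => by
      have d1 := f1 x ⟨by linarith [hx.1], hx.2⟩
      have d2 : exp (-(x - (s + l))) ≤ exp (-l) := exp_le_exp.2 (by linarith [hx.1])
      have d3 : K2 * (y / 12) ≤ K2 * (1 - exp (-(x - (s + l)))) := by gcongr; linarith
      linarith)
  have b0 : 0 ≤ F (s + 2 * l) := by
    have := hFmono s (s + 2 * l) hs0 (by linarith) (by linarith)
    linarith
  linarith

lemma aux_comm (c x y u v w : ℝ) :
    c * (x * y) * u * (v * w) = c * x * v * (u * (y * w)) := by ring

lemma aux_pts {τ y : ℝ} (hτ : 0 < τ) (hy : 0 < y) (hy1 : y ≤ 1) :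
    τ ≤ τ * (2 - y) ∧ τ * (2 - y) ≤ 2 * τ := by
  constructor <;> nlinarith


/-- Comparison argument, scattering-producing damping: `b : [0,∞) → [0,∞)`
nonnegative, continuous and integrable, with a lower bound on the first component
`F(t) ≥ A t^a` on `[T₀,T)`.  If `a(pq−1) + 2p + 1 > ρp + r`, there are `A₀ > 0` and `C > 0`
(independent of `A` and of the pair `(F,G)`) such that whenever `A ∈ (0,A₀]`, no such pair can
live on `[0,T)` beyond `C A^{−1/γ}`, `γ = a + (2p+1−(ρp+r))/(pq−1)`.  `C²([0,T))` is encoded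
through `F, G` together with their first and second derivative functions (one-sided at `0`),
the second derivatives being continuous. -/
theorem comparison_ODI_scattering_first_component
    (b : ℝ → ℝ)
    (hb_nonneg : ∀ t, 0 ≤ t → 0 ≤ b t)
    (hb_cont : ContinuousOn b (Set.Ici 0))
    (hb_int : IntegrableOn b (Set.Ioi 0) volume)
    (B B' R p q r ρ a T₀ : ℝ)
    (hB : 0 < B) (hB' : 0 < B') (hR : 0 < R)
    (hp : 1 < p) (hq : 1 < q) (hT₀ : 0 < T₀)
    (ha : ρ * p + r < a * (p * q - 1) + 2 * p + 1) :
    ∃ A₀ > 0, ∃ C > 0,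
      ∀ (T : ℝ) (F F' F'' G G' G'' : ℝ → ℝ) (A : ℝ),
        (∀ t ∈ Set.Ico (0 : ℝ) T, HasDerivWithinAt F (F' t) (Set.Ico 0 T) t) →
        (∀ t ∈ Set.Ico (0 : ℝ) T, HasDerivWithinAt F' (F'' t) (Set.Ico 0 T) t) →
        ContinuousOn F'' (Set.Ico 0 T) →
        (∀ t ∈ Set.Ico (0 : ℝ) T, HasDerivWithinAt G (G' t) (Set.Ico 0 T) t) →
        (∀ t ∈ Set.Ico (0 : ℝ) T, HasDerivWithinAt G' (G'' t) (Set.Ico 0 T) t) →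
        ContinuousOn G'' (Set.Ico 0 T) →
        (∀ t ∈ Set.Ico (0 : ℝ) T, B * (R + t) ^ (-r) * |G t| ^ p ≤ F'' t + F' t) →
        (∀ t ∈ Set.Ico (0 : ℝ) T,
          B' * (R + t) ^ (-ρ) * |F t| ^ q ≤ G'' t + b t * G' t) →
        0 ≤ F 0 → 0 ≤ F' 0 → 0 ≤ G 0 → 0 ≤ G' 0 →
        0 < A → A ≤ A₀ →
        (∀ t ∈ Set.Ico T₀ T, A * t ^ a ≤ F t) →
        T ≤ C * A ^ (-(1 / (a + (2 * p + 1 - (ρ * p + r)) / (p * q - 1)))) := by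
  obtain ⟨m, M, hM, hm, hmM⟩ := aux_weight b hb_nonneg hb_cont hb_int
  have hpq : 0 < p * q - 1 := by nlinarith
  obtain ⟨γ, hγ⟩ : ∃ γ, γ = a + (2 * p + 1 - (ρ * p + r)) / (p * q - 1) := ⟨_, rfl⟩
  rw [← hγ]
  have hγE : γ * (p * q - 1) = a * (p * q - 1) + (2 * p + 1 - (ρ * p + r)) := by
    rw [hγ]; field_simp
  have hγpq : 0 < γ * (p * q - 1) := by rw [hγE]; linarith
  have hγ0 : 0 < γ := pos_of_mul_pos_left hγpq hpq.le
  obtain ⟨c0, hc0⟩ : ∃ c0, c0 = 1 / 72 * (B * min 1 ((3:ℝ) ^ (-r))) *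
      ((B' * min 1 ((3:ℝ) ^ (-ρ))) / (72 * M)) ^ p := ⟨_, rfl⟩
  have hcr : 0 < min 1 ((3:ℝ) ^ (-r)) := lt_min one_pos (by positivity)
  have hcρ : 0 < min 1 ((3:ℝ) ^ (-ρ)) := lt_min one_pos (by positivity)
  have hM0 : 0 < M := by linarith
  have hc0p : 0 < c0 := by rw [hc0]; positivity
  obtain ⟨D, hD⟩ : ∃ D, D = (2:ℝ) ^ ((2 + 2 * p) / (p * q - 1)) := ⟨_, rfl⟩
  have hD1 : 1 < D := by
    rw [hD]; exact Real.one_lt_rpow (by norm_num) (by positivity)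
  have hD0 : 0 < D := by linarith
  have hDpow : D ^ (p * q - 1) = (2:ℝ) ^ (2 + 2 * p) := by
    rw [hD, ← Real.rpow_mul (by norm_num)]; congr 1; field_simp
  obtain ⟨σ, hσ⟩ : ∃ σ, σ = T₀ + R + 1 + (D / c0) ^ (1 / (γ * (p * q - 1))) := ⟨_, rfl⟩
  have hx0 : 0 < (D / c0) ^ (1 / (γ * (p * q - 1))) := by positivity
  have hσ0 : 0 < σ := by rw [hσ]; positivity
  have hσbig : D ≤ c0 * σ ^ (γ * (p * q - 1)) := by
    have : D / c0 ≤ σ ^ (γ * (p * q - 1)) := by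
      calc D / c0 = ((D / c0) ^ (1 / (γ * (p * q - 1)))) ^ (γ * (p * q - 1)) := by
            rw [← Real.rpow_mul (by positivity), one_div_mul_cancel hγpq.ne', Real.rpow_one]
        _ ≤ _ := Real.rpow_le_rpow hx0.le (by rw [hσ]; linarith) hγpq.le
    rw [div_le_iff₀ hc0p] at this
    linarith
  refine ⟨1, one_pos, 2 * σ, by positivity, ?_⟩
  intro T F F' F'' G G' G'' A hF hF' _ hG hG' _ h1 h2 hF0 hF'0 hG0 hG'0 hA hA1 hlow
  by_contra! hT
  obtain ⟨τ, hτdef⟩ : ∃ τ, τ = σ * A ^ (-(1 / γ)) := ⟨_, rfl⟩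
  have hτT : 2 * τ < T := by rw [hτdef]; linarith
  have hA1' : 1 ≤ A ^ (-(1 / γ)) :=
    Real.one_le_rpow_of_pos_of_le_one_of_nonpos hA hA1 (by
      have : 0 < 1 / γ := by positivity
      linarith)
  have hτσ : σ ≤ τ := by rw [hτdef]; nlinarith
  have hτ1 : 1 ≤ τ := by linarith
  have hτR : R ≤ τ := by linarith
  have hτ0 : 0 < τ := by linarith
  have hstart : A * τ ^ a ≤ F τ := hlow τ ⟨by linarith, by linarith⟩
  have hΦ0 : 0 < A * τ ^ a := by positivity
  have hscale : τ ^ (2 * p + 1 - (ρ * p + r)) * (A * τ ^ a) ^ (p * q - 1) =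
      σ ^ (γ * (p * q - 1)) := by
    rw [Real.mul_rpow hA.le (by positivity), ← Real.rpow_mul hτ0.le]
    have e1 : τ ^ (2 * p + 1 - (ρ * p + r)) * (A ^ (p * q - 1) * τ ^ (a * (p * q - 1))) =
        A ^ (p * q - 1) * τ ^ (γ * (p * q - 1)) := by
      rw [hγE, Real.rpow_add hτ0]; ring
    rw [e1, hτdef, Real.mul_rpow hσ0.le (by positivity), ← Real.rpow_mul hA.le]
    have e2 : -(1 / γ) * (γ * (p * q - 1)) = -(p * q - 1) := by field_simp
    rw [e2, Real.rpow_neg hA.le]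
    have : A ^ (p * q - 1) ≠ 0 := by positivity
    field_simp
  have iter : ∀ k : ℕ, (A * τ ^ a) * D ^ k ≤ F (τ * (2 - (1 / 2) ^ k)) := by
    intro k
    induction k with
    | zero => norm_num; exact hstart
    | succ k ih =>
      have hy : (0:ℝ) < (1 / 2) ^ k := by positivity
      have hy1 : ((1:ℝ) / 2) ^ k ≤ 1 := pow_le_one₀ (by norm_num) (by norm_num)
      have hend : τ * (2 - (1 / 2) ^ k) + τ * (1 / 2) ^ k / 2 =
        τ * (2 - (1 / 2) ^ (k + 1)) := by rw [pow_succ]; ring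
      have hΦ : 0 < (A * τ ^ a) * D ^ k := by positivity
      have := aux_step (r := r) (ρ := ρ) hB hB' hR hp hq hM hb_nonneg hm hmM hF hF' hG hG' h1 h2
        hF'0 hG0 hG'0 hτ1 hτR hτT (s := τ * (2 - (1 / 2) ^ k)) (y := (1 / 2) ^ k)
        (aux_pts hτ0 hy hy1).1 hy hy1
        (by
          rw [hend]
          exact (aux_pts hτ0 (by positivity) (pow_le_one₀ (by norm_num) (by norm_num))).2)
        hΦ ih
      rw [hend, ← hc0] at this
      refine le_trans ?_ this
      have e1 : ((A * τ ^ a) * D ^ k) ^ (p * q) =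
          (A * τ ^ a) * D ^ k * ((A * τ ^ a) ^ (p * q - 1) * ((2:ℝ) ^ (2 + 2 * p)) ^ k) := by
        rw [show p * q = 1 + (p * q - 1) by ring, Real.rpow_add hΦ, Real.rpow_one,
          Real.mul_rpow hΦ0.le (by positivity), ← hDpow, ← Real.rpow_natCast D k,
          ← Real.rpow_mul hD0.le, ← Real.rpow_natCast (D ^ _) k, ← Real.rpow_mul hD0.le]
        ring_nf
      have e2 : (((1:ℝ) / 2) ^ k) ^ (2 + 2 * p) * ((2:ℝ) ^ (2 + 2 * p)) ^ k = 1 := by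
        rw [← Real.rpow_natCast _ k, ← Real.rpow_natCast _ k, ← Real.rpow_mul (by norm_num),
          ← Real.rpow_mul (by norm_num), mul_comm (k:ℝ), ← Real.mul_rpow (by norm_num)
          (by norm_num)]
        norm_num
      calc A * τ ^ a * D ^ (k + 1) = D * (A * τ ^ a * D ^ k) := by ring
        _ ≤ (c0 * σ ^ (γ * (p * q - 1))) * (A * τ ^ a * D ^ k) := by gcongr
        _ = c0 * (τ ^ (2 * p + 1 - (ρ * p + r)) * (A * τ ^ a) ^ (p * q - 1)) *
            (A * τ ^ a * D ^ k) *
            ((((1:ℝ) / 2) ^ k) ^ (2 + 2 * p) * ((2:ℝ) ^ (2 + 2 * p)) ^ k) := by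
              rw [hscale, e2]; ring
        _ = c0 * τ ^ (2 * p + 1 - (ρ * p + r)) * (((1:ℝ) / 2) ^ k) ^ (2 + 2 * p) *
            ((A * τ ^ a) * D ^ k * ((A * τ ^ a) ^ (p * q - 1) * ((2:ℝ) ^ (2 + 2 * p)) ^ k)) :=
              aux_comm _ _ _ _ _ _
        _ = _ := by rw [e1]
  -- F is bounded on the compact interval `[0, 2 τ]`, contradiction
  have hcont : ContinuousOn F (Set.Icc 0 (2 * τ)) := fun t ht =>
    ((hF t ⟨ht.1, ht.2.trans_lt hτT⟩).mono
      (fun x hx => ⟨hx.1, hx.2.trans_lt hτT⟩)).continuousWithinAt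
  obtain ⟨N, hN⟩ := (isCompact_Icc.image_of_continuousOn hcont).bddAbove
  obtain ⟨k, hk⟩ := pow_unbounded_of_one_lt (N / (A * τ ^ a)) hD1
  rw [div_lt_iff₀ hΦ0] at hk
  have hy : (0:ℝ) < (1 / 2) ^ k := by positivity
  have hy1 : ((1:ℝ) / 2) ^ k ≤ 1 := pow_le_one₀ (by norm_num) (by norm_num)
  have := hN (Set.mem_image_of_mem F (show τ * (2 - (1 / 2) ^ k) ∈ Set.Icc 0 (2 * τ) from
    ⟨hτ0.le.trans (aux_pts hτ0 hy hy1).1, (aux_pts hτ0 hy hy1).2⟩))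
  linarith [iter k]
end

section
/- Let b : [0,∞) → [0,∞) be a nonnegative, continuous, integrable function. Let B, B̃, R > 0, p, q > 1, r, ρ ∈ ℝ, and let F, G ∈ C²([0,T)) satisfy F''(t) + F'(t) ≥ B (R+t)^{−r} |G(t)|^p and G''(t) + b(t) G'(t) ≥ B̃ (R+t)^{−ρ} |F(t)|^q for all t ∈ [0,T), together with F(0), F'(0), G(0), G'(0) ≥ 0. Suppose that for some T₀ > 0, Ã > 0 and α ∈ ℝ one has G(t) ≥ Ã t^α for all t ∈ [T₀,T), and that α(pq−1) + q + 2 > rq + ρ. Then there exist constants Ã₀ = Ã₀(α,T₀,R,p,q,r,ρ,b,B,B̃) > 0 and C̃ > 0 independent of Ã such that if Ã ∈ (0, Ã₀], then T is finite and T ≤ C̃ Ã^{−1/γ}, where γ = α + (q + 2 − (rq + ρ))/(pq−1). -/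
open Real Set MeasureTheory

lemma odi_mono {T : ℝ} {f f' : ℝ → ℝ}
    (hf : ∀ t ∈ Set.Ico (0 : ℝ) T, HasDerivWithinAt f (f' t) (Set.Ico 0 T) t)
    {a c : ℝ} (ha : 0 ≤ a) (hac : a ≤ c) (hc : c < T)
    (h : ∀ t ∈ Set.Ioo a c, 0 ≤ f' t) : f a ≤ f c := by
  have hsub : Set.Icc a c ⊆ Set.Ico 0 T := fun t ht => ⟨ha.trans ht.1, ht.2.trans_lt hc⟩
  have hm : MonotoneOn f (Set.Icc a c) := by
    apply monotoneOn_of_hasDerivWithinAt_nonneg (f' := f') (convex_Icc a c)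
    · exact fun t ht => ((hf t (hsub ht)).continuousWithinAt).mono hsub
    · intro t ht
      exact (hf t (hsub (interior_subset ht))).mono (interior_subset.trans hsub)
    · intro t ht
      rw [interior_Icc] at ht
      exact h t ht
  exact hm ⟨le_rfl, hac⟩ ⟨hac, le_rfl⟩ hac

/-- A damped function with bounded damping primitive. -/
lemma odi_damped {T I : ℝ} {G G' G'' b β : ℝ → ℝ}
    (hG : ∀ t ∈ Set.Ico (0 : ℝ) T, HasDerivWithinAt G (G' t) (Set.Ico 0 T) t)
    (hG' : ∀ t ∈ Set.Ico (0 : ℝ) T, HasDerivWithinAt G' (G'' t) (Set.Ico 0 T) t)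
    (hβ : ∀ t ∈ Set.Ico (0 : ℝ) T, HasDerivWithinAt β (b t) (Set.Ico 0 T) t)
    (hβ0 : ∀ t ∈ Set.Ico (0 : ℝ) T, 0 ≤ β t) (hβI : ∀ t ∈ Set.Ico (0 : ℝ) T, β t ≤ I)
    {a d m : ℝ} (ha : 0 ≤ a) (hd : 0 ≤ d) (hadT : a + d < T) (hm : 0 ≤ m)
    (hG'a : 0 ≤ G' a)
    (h : ∀ t ∈ Set.Ico a (a + d), m ≤ G'' t + b t * G' t) :
    0 ≤ G' (a + d) ∧ G a + rexp (-I) * m * d ^ 2 / 2 ≤ G (a + d) := by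
  have hE : ∀ t ∈ Set.Ico (0 : ℝ) T, HasDerivWithinAt (fun t => rexp (β t) * G' t - m * t)
      (rexp (β t) * (G'' t + b t * G' t) - m) (Set.Ico 0 T) t := by
    intro t ht
    have h1 := ((hβ t ht).exp.mul (hG' t ht)).sub ((hasDerivWithinAt_id t (Set.Ico 0 T)).const_mul m)
    refine h1.congr_deriv ?_
    ring
  have key : ∀ c, a ≤ c → c ≤ a + d → rexp (-I) * m * (c - a) ≤ G' c := by
    intro c hac hc
    have h1 := odi_mono hE ha hac (hc.trans_lt hadT) (by
      intro t ht
      have h2 := h t ⟨ht.1.le, ht.2.trans_le hc⟩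
      have h3 : 1 ≤ rexp (β t) := Real.one_le_exp
        (hβ0 t ⟨ha.trans ht.1.le, (ht.2.trans_le hc).trans hadT⟩)
      nlinarith)
    have hcT : c ∈ Set.Ico 0 T := ⟨ha.trans hac, hc.trans_lt hadT⟩
    have h4 : m * (c - a) ≤ rexp (β c) * G' c := by
      have : 0 ≤ rexp (β a) * G' a := by positivity
      beta_reduce at h1
      linarith
    have h5 : 0 ≤ m * (c - a) := mul_nonneg hm (by linarith)
    have h6 : 0 ≤ G' c := by
      have := h5.trans h4
      exact nonneg_of_mul_nonneg_right this (Real.exp_pos _)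
    have h7 : rexp (β c) ≤ rexp I := Real.exp_le_exp.2 (hβI c hcT)
    have h8 : m * (c - a) ≤ rexp I * G' c := h4.trans (by gcongr)
    calc rexp (-I) * m * (c - a) = rexp (-I) * (m * (c - a)) := by ring
      _ ≤ rexp (-I) * (rexp I * G' c) := by gcongr
      _ = G' c := by rw [← mul_assoc, ← Real.exp_add]; simp
  refine ⟨?_, ?_⟩
  · refine le_trans ?_ (key (a + d) (by linarith) le_rfl)
    have : 0 ≤ a + d - a := by linarith
    positivity
  · have hH : ∀ t ∈ Set.Ico (0 : ℝ) T,
        HasDerivWithinAt (fun t => G t - rexp (-I) * m / 2 * (t - a) ^ 2)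
        (G' t - rexp (-I) * m * (t - a)) (Set.Ico 0 T) t := by
      intro t ht
      have h1 := (hG t ht).sub
        (((((hasDerivWithinAt_id t (Set.Ico 0 T)).sub_const a).pow 2)).const_mul (rexp (-I) * m / 2))
      refine h1.congr_deriv ?_
      simp
      ring
    have h1 := odi_mono hH ha (by linarith : a ≤ a + d) hadT (by
      intro t ht
      have := key t ht.1.le ht.2.le
      linarith)
    simp only [sub_self, add_sub_cancel_left] at h1
    nlinarith

/-- The equation with unit damping. -/
lemma odi_unit {T : ℝ} {F F' F'' : ℝ → ℝ}
    (hF : ∀ t ∈ Set.Ico (0 : ℝ) T, HasDerivWithinAt F (F' t) (Set.Ico 0 T) t)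
    (hF' : ∀ t ∈ Set.Ico (0 : ℝ) T, HasDerivWithinAt F' (F'' t) (Set.Ico 0 T) t)
    (hFn : ∀ t ∈ Set.Ico (0 : ℝ) T, 0 ≤ F t) (hF'n : ∀ t ∈ Set.Ico (0 : ℝ) T, 0 ≤ F' t)
    {a d m : ℝ} (ha : 0 ≤ a) (hd : 0 ≤ d) (hadT : a + d < T)
    (h : ∀ t ∈ Set.Ico a (a + d), m ≤ F'' t + F' t) :
    m * d ^ 2 ≤ (4 + 2 * d) * F (a + d) := by
  have h1 : ∀ c, a ≤ c → c ≤ a + d → m * (c - a) ≤ F' c + F c := by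
    intro c hac hc
    have hE : ∀ t ∈ Set.Ico (0 : ℝ) T, HasDerivWithinAt (fun t => F' t + F t - m * t)
        (F'' t + F' t - m) (Set.Ico 0 T) t := by
      intro t ht
      have h1 := ((hF' t ht).add (hF t ht)).sub
        ((hasDerivWithinAt_id t (Set.Ico 0 T)).const_mul m)
      exact h1.congr_deriv (by ring)
    have h2 := odi_mono hE ha hac (hc.trans_lt hadT) (by
      intro t ht
      have := h t ⟨ht.1.le, ht.2.trans_le hc⟩
      linarith)
    have h3 := hFn a ⟨ha, by linarith⟩
    have h4 := hF'n a ⟨ha, by linarith⟩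
    beta_reduce at h2
    linarith
  by_cases hm : 0 ≤ m
  swap
  · have := hFn (a + d) ⟨by linarith, hadT⟩
    push Not at hm
    nlinarith [sq_nonneg d, mul_nonneg hd this]
  have hH : ∀ t ∈ Set.Ico (0 : ℝ) T,
      HasDerivWithinAt (fun t => F t - (m * d / 2 - F (a + d)) * t)
      (F' t - (m * d / 2 - F (a + d))) (Set.Ico 0 T) t := by
    intro t ht
    have h1 := (hF t ht).sub ((hasDerivWithinAt_id t (Set.Ico 0 T)).const_mul
      (m * d / 2 - F (a + d)))
    exact h1.congr_deriv (by ring)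
  have h2 := odi_mono hH (by linarith : 0 ≤ a + d / 2) (by linarith : a + d / 2 ≤ a + d) hadT (by
    intro t ht
    have h3 := h1 t (by linarith [ht.1]) ht.2.le
    have h4 : F t ≤ F (a + d) := odi_mono hF (by linarith [ht.1]) ht.2.le hadT (by
      intro s hs
      exact hF'n s ⟨by linarith [ht.1, hs.1], by linarith [hs.2]⟩)
    nlinarith [ht.1])
  have h5 := hFn (a + d / 2) ⟨by linarith, by linarith⟩
  beta_reduce at h2
  nlinarith

lemma odi_seq {P M D : ℝ} (hP : 1 < P) (hM : 1 < M) (hD : 0 < D) (x : ℕ → ℝ)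
    (hx0 : 0 < x 0) (Y : ℝ) (hY : ∀ k : ℕ, x k ≤ Y)
    (hx : ∀ k : ℕ, D * M ^ (-(k : ℝ)) * x k ^ P ≤ x (k + 1)) :
    D * x 0 ^ (P - 1) < M ^ (1 / (P - 1)) := by
  by_contra hcon
  push Not at hcon
  have hP1 : 0 < P - 1 := by linarith
  have hM0 : 0 < M := by linarith
  set L := M ^ (1 / (P - 1)) with hL
  have hL1 : 1 < L := Real.one_lt_rpow hM (by positivity)
  have hL0 : 0 < L := by linarith
  have hLM : M = L ^ (P - 1) := by
    rw [hL, ← Real.rpow_mul hM0.le, one_div_mul_cancel hP1.ne', Real.rpow_one]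
  have claim : ∀ k : ℕ, x 0 * L ^ k ≤ x k := by
    intro k
    induction k with
    | zero => simp
    | succ k ih =>
      refine le_trans ?_ (hx k)
      have hpos : 0 < x 0 * L ^ k := by positivity
      have h1 : (x 0 * L ^ k) ^ P ≤ x k ^ P := Real.rpow_le_rpow hpos.le ih (by linarith)
      have h2 : D * M ^ (-(k : ℝ)) * (x 0 * L ^ k) ^ P = D * x 0 ^ (P - 1) * (x 0 * L ^ k) := by
        rw [Real.mul_rpow hx0.le (by positivity), ← Real.rpow_natCast L k,
          ← Real.rpow_mul hL0.le, hLM, ← Real.rpow_mul hL0.le]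
        have e1 : x 0 ^ P = x 0 ^ (P - 1) * x 0 := by
          rw [← Real.rpow_add_one hx0.ne']; ring_nf
        have e2 : L ^ (k : ℝ) = L ^ ((P - 1) * -(k : ℝ)) * L ^ ((k : ℝ) * P) := by
          rw [← Real.rpow_add hL0]; ring_nf
        rw [e1, e2]; ring
      calc x 0 * L ^ (k + 1) = L * (x 0 * L ^ k) := by ring
        _ ≤ D * x 0 ^ (P - 1) * (x 0 * L ^ k) := by gcongr
        _ = D * M ^ (-(k : ℝ)) * (x 0 * L ^ k) ^ P := h2.symm
        _ ≤ _ := by gcongr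
  obtain ⟨n, hn⟩ := pow_unbounded_of_one_lt (Y / x 0) hL1
  have := (claim n).trans (hY n)
  rw [div_lt_iff₀ hx0] at hn
  linarith

lemma odi_weight {S R t : ℝ} (r : ℝ) (hS : 0 < S) (hR : 0 < R) (hRS : R ≤ S)
    (h1 : S ≤ t) (h2 : t ≤ 2 * S) : 3 ^ (-|r|) * S ^ (-r) ≤ (R + t) ^ (-r) := by
  have h3 : (0 : ℝ) < 3 ^ (-|r|) := by positivity
  have h4 : (3 : ℝ) ^ (-|r|) ≤ 1 :=
    Real.rpow_le_one_of_one_le_of_nonpos (by norm_num) (by simp)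
  rcases le_total 0 r with hr | hr
  · rw [abs_of_nonneg hr, ← Real.mul_rpow (by norm_num) hS.le]
    exact Real.rpow_le_rpow_of_nonpos (by linarith) (by linarith) (by linarith)
  · calc 3 ^ (-|r|) * S ^ (-r) ≤ 1 * S ^ (-r) := by gcongr
      _ = S ^ (-r) := one_mul _
      _ ≤ (R + t) ^ (-r) := Real.rpow_le_rpow hS.le (by linarith) (by linarith)

lemma odi_primitive (b : ℝ → ℝ)
    (hb_nonneg : ∀ t, 0 ≤ t → 0 ≤ b t)
    (hb_cont : ContinuousOn b (Set.Ici 0))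
    (hb_int : IntegrableOn b (Set.Ioi 0) volume) :
    ∃ (I : ℝ) (β : ℝ → ℝ), (∀ T, ∀ t ∈ Set.Ico (0 : ℝ) T, HasDerivWithinAt β (b t) (Set.Ico 0 T) t) ∧
      (∀ t, 0 ≤ t → 0 ≤ β t) ∧ (∀ t, 0 ≤ t → β t ≤ I) := by
  let c : ℝ → ℝ := fun t => b (max t 0)
  have hc : Continuous c :=
    hb_cont.comp_continuous (by fun_prop) (fun t => le_max_right t 0)
  have hcb : ∀ t, 0 ≤ t → c t = b t := fun t ht => by simp [c, max_eq_left ht]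
  refine ⟨∫ t in Set.Ioi 0, b t, fun t => ∫ s in (0:ℝ)..t, c s, ?_, ?_, ?_⟩
  · intro T t ht
    rw [← hcb t ht.1]
    exact (hc.integral_hasStrictDerivAt 0 t).hasDerivAt.hasDerivWithinAt
  · intro t ht
    exact intervalIntegral.integral_nonneg ht
      (fun s hs => by rw [hcb s hs.1]; exact hb_nonneg s hs.1)
  · intro t ht
    simp only
    rw [intervalIntegral.integral_of_le ht,
      setIntegral_congr_fun measurableSet_Ioc (fun s hs => hcb s hs.1.le)]
    apply setIntegral_mono_set hb_int
    · filter_upwards [ae_restrict_mem measurableSet_Ioi] with s hs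
      exact hb_nonneg s (le_of_lt hs)
    · exact Filter.Eventually.of_forall (fun s hs => hs.1)

/-- Power bookkeeping in one step. -/
lemma odi_alg {E B B' c₁ c₂ S η x p q r ρ : ℝ} (hB : 0 < B) (hc₁ : 0 < c₁)
    (hS : 0 < S) (hη : 0 < η) (hx : 0 < x) :
    E * (B' * (c₂ * S ^ (-ρ)) * ((B * (c₁ * S ^ (-r)) * x ^ p) * (S * η) ^ 2 / (6 * S)) ^ q)
        * (S * η) ^ 2 / 2
      = (E / 2 * B' * c₂ * (B * c₁ / 6) ^ q) * S ^ (q + 2 - (r * q + ρ)) * η ^ (2 + 2 * q)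
        * x ^ (p * q) := by
  have e0 : (B * (c₁ * S ^ (-r)) * x ^ p) * (S * η) ^ 2 / (6 * S)
      = (B * c₁ / 6) * S ^ (1 - r) * η ^ (2 : ℝ) * x ^ p := by
    rw [sub_eq_add_neg, Real.rpow_add hS, Real.rpow_one, Real.rpow_two]
    field_simp
  rw [e0, Real.mul_rpow (by positivity) (by positivity),
    Real.mul_rpow (by positivity) (by positivity),
    Real.mul_rpow (by positivity) (by positivity),
    ← Real.rpow_mul hS.le, ← Real.rpow_mul hη.le, ← Real.rpow_mul hx.le]
  have e1 : S ^ (q + 2 - (r * q + ρ)) = S ^ (-ρ) * S ^ ((1 - r) * q) * S ^ 2 := by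
    rw [← Real.rpow_two, ← Real.rpow_add hS, ← Real.rpow_add hS]; ring_nf
  have e2 : η ^ (2 + 2 * q) = η ^ (2 * q) * η ^ 2 := by
    rw [← Real.rpow_two, ← Real.rpow_add hη]; ring_nf
  rw [e1, e2]; ring

/-- The contradiction on one dyadic block. -/
lemma odi_block {T I S B B' R p q r ρ : ℝ} {F F' F'' G G' G'' b β : ℝ → ℝ}
    (hβ : ∀ t ∈ Set.Ico (0 : ℝ) T, HasDerivWithinAt β (b t) (Set.Ico 0 T) t)
    (hβ0 : ∀ t ∈ Set.Ico (0 : ℝ) T, 0 ≤ β t) (hβI : ∀ t ∈ Set.Ico (0 : ℝ) T, β t ≤ I)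
    (hB : 0 < B) (hB' : 0 < B') (hR : 0 < R) (hp : 1 < p) (hq : 1 < q)
    (hF : ∀ t ∈ Set.Ico (0 : ℝ) T, HasDerivWithinAt F (F' t) (Set.Ico 0 T) t)
    (hF' : ∀ t ∈ Set.Ico (0 : ℝ) T, HasDerivWithinAt F' (F'' t) (Set.Ico 0 T) t)
    (hG : ∀ t ∈ Set.Ico (0 : ℝ) T, HasDerivWithinAt G (G' t) (Set.Ico 0 T) t)
    (hG' : ∀ t ∈ Set.Ico (0 : ℝ) T, HasDerivWithinAt G' (G'' t) (Set.Ico 0 T) t)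
    (h1 : ∀ t ∈ Set.Ico (0 : ℝ) T, B * (R + t) ^ (-r) * |G t| ^ p ≤ F'' t + F' t)
    (h2 : ∀ t ∈ Set.Ico (0 : ℝ) T,
          B' * (R + t) ^ (-ρ) * |F t| ^ q ≤ G'' t + b t * G' t)
    (hF0 : 0 ≤ F 0) (hF'0 : 0 ≤ F' 0) (hG0 : 0 ≤ G 0) (hG'0 : 0 ≤ G' 0)
    (hS1 : 1 ≤ S) (hSR : R ≤ S) (hST : 2 * S < T) (hGS : 0 < G S) :
    (rexp (-I) / 2 * B' * 3 ^ (-|ρ|) * (B * 3 ^ (-|r|) / 6) ^ q) * (1 / 4) ^ (2 + 2 * q)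
      * S ^ (q + 2 - (r * q + ρ)) * G S ^ (p * q - 1)
      < ((2 : ℝ) ^ (2 + 2 * q)) ^ (1 / (p * q - 1)) := by
  have hS0 : 0 < S := by linarith
  have hG'n : ∀ t ∈ Set.Ico (0 : ℝ) T, 0 ≤ G' t := by
    intro t ht
    have := (odi_damped hG hG' hβ hβ0 hβI (a := 0) (d := t) (m := 0) le_rfl ht.1
      (by simpa using ht.2) le_rfl hG'0 (by
        intro s hs
        rw [zero_add] at hs
        have hs0 : 0 ≤ R + s := by linarith [hs.1]
        exact le_trans (by positivity) (h2 s ⟨hs.1, hs.2.trans ht.2⟩))).1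
    simpa using this
  have hF'n : ∀ t ∈ Set.Ico (0 : ℝ) T, 0 ≤ F' t := by
    intro t ht
    have := (odi_damped (b := fun _ => 1) (β := fun t => t) (I := T) hF hF'
      (fun t _ => hasDerivWithinAt_id t _) (fun t ht => ht.1) (fun t ht => ht.2.le)
      (a := 0) (d := t) (m := 0) le_rfl ht.1
      (by simpa using ht.2) le_rfl hF'0 (by
        intro s hs
        rw [zero_add] at hs
        have hs0 : 0 ≤ R + s := by linarith [hs.1]
        rw [one_mul]
        exact le_trans (by positivity) (h1 s ⟨hs.1, hs.2.trans ht.2⟩))).1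
    simpa using this
  have hGm : ∀ a c, 0 ≤ a → a ≤ c → c < T → G a ≤ G c := fun a c ha hac hc =>
    odi_mono hG ha hac hc (fun t ht => hG'n t ⟨by linarith [ht.1], by linarith [ht.2]⟩)
  have hFm : ∀ a c, 0 ≤ a → a ≤ c → c < T → F a ≤ F c := fun a c ha hac hc =>
    odi_mono hF ha hac hc (fun t ht => hF'n t ⟨by linarith [ht.1], by linarith [ht.2]⟩)
  have hFn : ∀ t ∈ Set.Ico (0 : ℝ) T, 0 ≤ F t := fun t ht =>
    hF0.trans (hFm 0 t le_rfl ht.1 ht.2)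
  set cc := (rexp (-I) / 2 * B' * 3 ^ (-|ρ|) * (B * 3 ^ (-|r|) / 6) ^ q) with hcc
  -- one step
  have step : ∀ a η, S ≤ a → 0 < η → η ≤ 1 → a + 2 * (S * η) ≤ 2 * S →
      cc * S ^ (q + 2 - (r * q + ρ)) * η ^ (2 + 2 * q) * G a ^ (p * q)
        ≤ G (a + 2 * (S * η)) := by
    intro a η hSa hη hη1 hend
    have hd : 0 < S * η := by positivity
    have hdS : S * η ≤ S := by nlinarith
    have hGa : 0 < G a := hGS.trans_le (hGm S a hS0.le hSa (by linarith))
    set m := B * (3 ^ (-|r|) * S ^ (-r)) * G a ^ p with hm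
    have hm0 : 0 ≤ m := by positivity
    have s1 := odi_unit hF hF' hFn hF'n (a := a) (d := S * η) (m := m) (by linarith) hd.le
      (by linarith) (by
        intro t ht
        refine le_trans ?_ (h1 t ⟨by linarith [ht.1], by linarith [ht.2]⟩)
        have hw := odi_weight (t := t) r hS0 hR hSR (by linarith [ht.1]) (by linarith [ht.2])
        have hRt : 0 ≤ R + t := by linarith [ht.1]
        have hg : G a ≤ |G t| := (hGm a t (by linarith) ht.1 (by linarith [ht.2])).trans (le_abs_self _)
        have hg2 : G a ^ p ≤ |G t| ^ p := Real.rpow_le_rpow hGa.le hg (by linarith)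
        rw [hm]
        gcongr)
    set z := m * (S * η) ^ 2 / (6 * S) with hz
    have hz0 : 0 ≤ z := by positivity
    have s2 : z ≤ F (a + S * η) := by
      rw [hz, div_le_iff₀ (by positivity)]
      have := hFn (a + S * η) ⟨by linarith, by linarith⟩
      nlinarith
    have s3 := (odi_damped hG hG' hβ hβ0 hβI (a := a + S * η) (d := S * η)
      (m := B' * (3 ^ (-|ρ|) * S ^ (-ρ)) * z ^ q) (by linarith) hd.le (by linarith)
      (by positivity) (hG'n _ ⟨by linarith, by linarith⟩) (by
        intro t ht
        refine le_trans ?_ (h2 t ⟨by linarith [ht.1], by linarith [ht.2]⟩)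
        have hw := odi_weight (t := t) ρ hS0 hR hSR (by linarith [ht.1]) (by linarith [ht.2])
        have hRt : 0 ≤ R + t := by linarith [ht.1]
        have hg : z ≤ |F t| :=
          (s2.trans (hFm _ t (by linarith) ht.1 (by linarith [ht.2]))).trans (le_abs_self _)
        have hg2 : z ^ q ≤ |F t| ^ q := Real.rpow_le_rpow hz0 hg (by linarith)
        gcongr)).2
    have hgp : 0 ≤ G (a + S * η) :=
      hGa.le.trans (hGm a _ (by linarith) (by linarith) (by linarith))
    have e := odi_alg (E := rexp (-I)) (B := B) (B' := B') (c₁ := 3 ^ (-|r|)) (c₂ := 3 ^ (-|ρ|))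
      (S := S) (η := η) (x := G a) (p := p) (q := q) (r := r) (ρ := ρ) hB (by positivity) hS0 hη hGa
    rw [← hm, ← hz, ← hcc] at e
    rw [← e]
    have e3 : a + 2 * (S * η) = a + S * η + S * η := by ring
    rw [e3]
    linarith
  have hpq : 1 < p * q := by nlinarith
  have hhalf : ∀ k : ℕ, (0 : ℝ) < (1 / 2) ^ k ∧ ((1 : ℝ) / 2) ^ k ≤ 1 := fun k =>
    ⟨by positivity, pow_le_one₀ (by norm_num) (by norm_num)⟩
  have hcc0 : 0 < cc := by positivity
  have hs := odi_seq (P := p * q) (M := 2 ^ (2 + 2 * q))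
    (D := cc * (1 / 4) ^ (2 + 2 * q) * S ^ (q + 2 - (r * q + ρ))) hpq
    (Real.one_lt_rpow (by norm_num) (by linarith)) (by positivity)
    (fun k => G (S * (2 - (1 / 2) ^ k))) (by norm_num; exact hGS) (G (2 * S))
    (by
      intro k
      obtain ⟨k1, k2⟩ := hhalf k
      exact hGm _ _ (by nlinarith) (by nlinarith) hST)
    (by
      intro k
      obtain ⟨k1, k2⟩ := hhalf k
      have := step (S * (2 - (1 / 2) ^ k)) ((1 / 2) ^ k * (1 / 4)) (by nlinarith) (by positivity)
        (by linarith) (by nlinarith)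
      have e1 : S * (2 - (1 / 2) ^ k) + 2 * (S * ((1 / 2) ^ k * (1 / 4)))
          = S * (2 - (1 / 2) ^ (k + 1)) := by rw [pow_succ]; ring
      have e2 : ((1 / 2 : ℝ) ^ k * (1 / 4)) ^ (2 + 2 * q)
          = (1 / 4) ^ (2 + 2 * q) * ((2 : ℝ) ^ (2 + 2 * q)) ^ (-(k : ℝ)) := by
        rw [Real.mul_rpow (by positivity) (by positivity), mul_comm]
        congr 1
        rw [← Real.rpow_natCast, ← Real.rpow_mul (by norm_num), ← Real.rpow_mul (by norm_num),
          one_div, Real.inv_rpow (by norm_num), ← Real.rpow_neg (by norm_num)]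
        congr 1
        ring
      rw [e1, e2] at this
      refine le_trans (le_of_eq ?_) this
      ring)
  norm_num at hs ⊢
  exact hs

/-- Comparison argument, scattering-producing damping: `b : [0,∞) → [0,∞)`
nonnegative, continuous and integrable, with a lower bound on the second component
`G(t) ≥ Ã t^α` on `[T₀,T)`.  If `α(pq−1) + q + 2 > rq + ρ`, there are `Ã₀ > 0` and `C̃ > 0`
(independent of `Ã` and of the pair `(F,G)`) such that whenever `Ã ∈ (0,Ã₀]`, no such pair can
live on `[0,T)` beyond `C̃ Ã^{−1/γ}`, `γ = α + (q+2−(rq+ρ))/(pq−1)`.  `C²([0,T))` is encoded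
through `F, G` together with their first and second derivative functions (one-sided at `0`),
the second derivatives being continuous. -/
theorem comparison_ODI_scattering_second_component
    (b : ℝ → ℝ)
    (hb_nonneg : ∀ t, 0 ≤ t → 0 ≤ b t)
    (hb_cont : ContinuousOn b (Set.Ici 0))
    (hb_int : IntegrableOn b (Set.Ioi 0) volume)
    (B B' R p q r ρ α T₀ : ℝ)
    (hB : 0 < B) (hB' : 0 < B') (hR : 0 < R)
    (hp : 1 < p) (hq : 1 < q) (hT₀ : 0 < T₀)
    (hα : r * q + ρ < α * (p * q - 1) + q + 2) :
    ∃ A₀ > 0, ∃ C > 0,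
      ∀ (T : ℝ) (F F' F'' G G' G'' : ℝ → ℝ) (A : ℝ),
        (∀ t ∈ Set.Ico (0 : ℝ) T, HasDerivWithinAt F (F' t) (Set.Ico 0 T) t) →
        (∀ t ∈ Set.Ico (0 : ℝ) T, HasDerivWithinAt F' (F'' t) (Set.Ico 0 T) t) →
        ContinuousOn F'' (Set.Ico 0 T) →
        (∀ t ∈ Set.Ico (0 : ℝ) T, HasDerivWithinAt G (G' t) (Set.Ico 0 T) t) →
        (∀ t ∈ Set.Ico (0 : ℝ) T, HasDerivWithinAt G' (G'' t) (Set.Ico 0 T) t) →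
        ContinuousOn G'' (Set.Ico 0 T) →
        (∀ t ∈ Set.Ico (0 : ℝ) T, B * (R + t) ^ (-r) * |G t| ^ p ≤ F'' t + F' t) →
        (∀ t ∈ Set.Ico (0 : ℝ) T,
          B' * (R + t) ^ (-ρ) * |F t| ^ q ≤ G'' t + b t * G' t) →
        0 ≤ F 0 → 0 ≤ F' 0 → 0 ≤ G 0 → 0 ≤ G' 0 →
        0 < A → A ≤ A₀ →
        (∀ t ∈ Set.Ico T₀ T, A * t ^ α ≤ G t) →
        T ≤ C * A ^ (-(1 / (α + (q + 2 - (r * q + ρ)) / (p * q - 1)))) := by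
  obtain ⟨I, β, hβ, hβ0, hβI⟩ := odi_primitive b hb_nonneg hb_cont hb_int
  have hpq : 0 < p * q - 1 := by nlinarith
  set γ := α + (q + 2 - (r * q + ρ)) / (p * q - 1) with hγ
  have hγe : γ * (p * q - 1) = α * (p * q - 1) + (q + 2 - (r * q + ρ)) := by
    rw [hγ, add_mul, div_mul_cancel₀ _ hpq.ne']
  have hγ0 : 0 < γ := by
    by_contra hc
    push Not at hc
    nlinarith
  obtain ⟨c, hc⟩ : ∃ c, c = (rexp (-I) / 2 * B' * 3 ^ (-|ρ|) * (B * 3 ^ (-|r|) / 6) ^ q)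
    * (1 / 4) ^ (2 + 2 * q) := ⟨_, rfl⟩
  have hc0 : 0 < c := by rw [hc]; positivity
  obtain ⟨L, hL⟩ : ∃ L, L = ((2 : ℝ) ^ (2 + 2 * q)) ^ (1 / (p * q - 1)) := ⟨_, rfl⟩
  have hL0 : 0 < L := by rw [hL]; positivity
  set S₀ := max 1 (max R T₀) with hS₀
  have hS1 : 1 ≤ S₀ := le_max_left _ _
  have hSR : R ≤ S₀ := (le_max_left _ _).trans (le_max_right _ _)
  have hST : T₀ ≤ S₀ := (le_max_right _ _).trans (le_max_right _ _)
  set K := (L / c) ^ (1 / (γ * (p * q - 1))) with hK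
  have hK0 : 0 < K := by positivity
  refine ⟨1, one_pos, max (3 * S₀) (3 * K), lt_max_of_lt_right (by positivity), ?_⟩
  intro T F F' F'' G G' G'' A hF hF' _ hG hG' _ h1 h2 hF0 hF'0 hG0 hG'0 hA hA1 hlow
  have hAp : 0 < A ^ (-(1 / γ)) := by positivity
  by_cases hT : T ≤ 3 * S₀
  · have h3 : 1 ≤ A ^ (-(1 / γ)) :=
      Real.one_le_rpow_of_pos_of_le_one_of_nonpos hA hA1 (by
        have : 0 < 1 / γ := by positivity
        linarith)
    calc T ≤ 3 * S₀ := hT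
      _ ≤ max (3 * S₀) (3 * K) * 1 := by rw [mul_one]; exact le_max_left _ _
      _ ≤ _ := by gcongr
  push Not at hT
  obtain ⟨S, hS⟩ : ∃ S, S = T / 3 := ⟨_, rfl⟩
  have hTS : T = 3 * S := by rw [hS]; ring
  have hSS : S₀ < S := by linarith
  have hSpos : 0 < S := by linarith
  have hGl := hlow S ⟨by linarith, by linarith⟩
  have hAS : 0 < A * S ^ α := by positivity
  have hblock := odi_block (hβ T) (fun t ht => hβ0 t ht.1) (fun t ht => hβI t ht.1)
    hB hB' hR hp hq hF hF' hG hG' h1 h2 hF0 hF'0 hG0 hG'0 (S := S) (by linarith) (by linarith)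
    (by linarith) (hAS.trans_le hGl)
  rw [← hc, ← hL] at hblock
  have h5 : (A * S ^ α) ^ (p * q - 1) ≤ G S ^ (p * q - 1) :=
    Real.rpow_le_rpow hAS.le hGl hpq.le
  have h6 : c * S ^ (q + 2 - (r * q + ρ)) * (A * S ^ α) ^ (p * q - 1) ≤ L :=
    le_trans (by gcongr) hblock.le
  have h7 : c * S ^ (q + 2 - (r * q + ρ)) * (A * S ^ α) ^ (p * q - 1)
      = c * (A ^ (1 / γ) * S) ^ (γ * (p * q - 1)) := by
    rw [Real.mul_rpow hA.le (by positivity), Real.mul_rpow (by positivity) hSpos.le,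
      ← Real.rpow_mul hSpos.le, ← Real.rpow_mul hA.le, hγe, Real.rpow_add hSpos, ← hγe,
      ← mul_assoc (1 / γ), one_div_mul_cancel hγ0.ne', one_mul]
    ring
  have hγp : 0 < γ * (p * q - 1) := by positivity
  have h8 : A ^ (1 / γ) * S ≤ K := by
    have h9 : (A ^ (1 / γ) * S) ^ (γ * (p * q - 1)) ≤ L / c := by
      rw [le_div_iff₀ hc0]
      linarith
    have h10 := Real.rpow_le_rpow (by positivity) h9 (by positivity : 0 ≤ 1 / (γ * (p * q - 1)))
    rwa [← Real.rpow_mul (by positivity), mul_one_div_cancel hγp.ne', Real.rpow_one] at h10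
  have h11 : S ≤ K * A ^ (-(1 / γ)) := by
    rw [Real.rpow_neg hA.le, ← div_eq_mul_inv, le_div_iff₀ (by positivity)]
    linarith
  calc T = 3 * S := hTS
    _ ≤ 3 * (K * A ^ (-(1 / γ))) := by gcongr
    _ = (3 * K) * A ^ (-(1 / γ)) := by ring
    _ ≤ _ := by
      gcongr
      exact le_max_right _ _
end
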